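/- arXiv:0812.1270 — 5 statements merged into one kernel-verified Lean document; each statement's English description precedes it below -/
import Mathlib

section
/- For every finite collection s₁, …, s_m of nondegenerate closed line segments in ℝ³ (each sⱼ the convex hull of two distinct points), there exists a finite simplicial complex X of dimension ≤ 1 whose underlying polyhedron equals s₁ ∪ ⋯ ∪ s_m. -/
open Set

/-- `ℝ³` as `Fin 3 → ℝ`. -/
abbrev E3 : Type := Fin 3 → ℝ

section SegmentArrangement

variable {E : Type*} [AddCommGroup E] [Module ℝ E]

/-- A segment is contained in the line through any two of its distinct points. -/
lemma segment_subset_range_lineMap {p q x y : E} (hx : x ∈ segment ℝ p q)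
    (hy : y ∈ segment ℝ p q) (hxy : x ≠ y) :
    segment ℝ p q ⊆ range (AffineMap.lineMap (k := ℝ) x y) := by
  rw [segment_eq_image_lineMap] at *
  obtain ⟨s, -, rfl⟩ := hx
  obtain ⟨t, -, rfl⟩ := hy
  rintro _ ⟨r, -, rfl⟩
  have hst : t - s ≠ 0 := fun h => hxy (by rw [sub_eq_zero.1 h])
  refine ⟨(r - s) / (t - s), ?_⟩
  rw [← AffineMap.apply_lineMap]
  congr 1
  rw [AffineMap.lineMap_apply_ring']
  field_simp
  ring

lemma lineMap_mem_segment_lineMap_iff {x y : E} (hxy : x ≠ y) {a b c : ℝ} :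
    AffineMap.lineMap (k := ℝ) x y c ∈
      segment ℝ (AffineMap.lineMap (k := ℝ) x y a) (AffineMap.lineMap (k := ℝ) x y b) ↔
        c ∈ uIcc a b := by
  rw [← image_segment, (AffineMap.lineMap_injective ℝ hxy).mem_set_image, segment_eq_uIcc]

/-- Two segments on a common line which share a point other than an endpoint, and neither of which
contains an endpoint of the other in its interior, have the same endpoints. -/
lemma pair_eq_pair_of_mem_segment {x y a b c d : E} (hxy : x ≠ y)
    (ha : a ∈ range (AffineMap.lineMap (k := ℝ) x y))
    (hb : b ∈ range (AffineMap.lineMap (k := ℝ) x y))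
    (hc : c ∈ range (AffineMap.lineMap (k := ℝ) x y))
    (hd : d ∈ range (AffineMap.lineMap (k := ℝ) x y))
    (hxab : x ∈ segment ℝ a b) (hxcd : x ∈ segment ℝ c d)
    (hxa : x ≠ a) (hxb : x ≠ b) (hxc : x ≠ c) (hxd : x ≠ d)
    (hac : a ∈ segment ℝ c d → a = c ∨ a = d) (hbc : b ∈ segment ℝ c d → b = c ∨ b = d)
    (hca : c ∈ segment ℝ a b → c = a ∨ c = b) (hda : d ∈ segment ℝ a b → d = a ∨ d = b) :
    ({a, b} : Set E) = {c, d} := by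
  obtain ⟨a, rfl⟩ := ha
  obtain ⟨b, rfl⟩ := hb
  obtain ⟨c, rfl⟩ := hc
  obtain ⟨d, rfl⟩ := hd
  have hx : x = AffineMap.lineMap (k := ℝ) x y 0 := by simp
  have hinj := AffineMap.lineMap_injective ℝ hxy
  have hne {t : ℝ} (h : x ≠ AffineMap.lineMap (k := ℝ) x y t) : t ≠ 0 := by
    rintro rfl
    exact h hx
  have hmem {s t : ℝ} (h : x ∈ segment ℝ (AffineMap.lineMap (k := ℝ) x y s)
      (AffineMap.lineMap (k := ℝ) x y t)) : (0 : ℝ) ∈ uIcc s t := by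
    rw [← lineMap_mem_segment_lineMap_iff hxy, ← hx]
    exact h
  have h1 := hmem hxab
  have h2 := hmem hxcd
  have h3 := hne hxa
  have h4 := hne hxb
  have h5 := hne hxc
  have h6 := hne hxd
  simp only [lineMap_mem_segment_lineMap_iff hxy, hinj.eq_iff, mem_uIcc] at *
  rw [← image_pair, ← image_pair, hinj.image_injective.eq_iff, pair_eq_pair_iff]
  clear hne hmem hx hinj hxa hxb hxc hxd
  grind

/-- The endpoints of finitely many segments, together with the pairwise intersections which are
finite. -/
def arrangementVertices {ι : Type*} (p q : ι → E) : Set E :=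
  (range p ∪ range q) ∪ ⋃ (i : ι) (j : ι)
    (_ : (segment ℝ (p i) (q i) ∩ segment ℝ (p j) (q j)).Finite),
    segment ℝ (p i) (q i) ∩ segment ℝ (p j) (q j)

lemma finite_arrangementVertices {ι : Type*} [Finite ι] (p q : ι → E) :
    (arrangementVertices p q).Finite :=
  ((finite_range p).union (finite_range q)).union <|
    finite_iUnion fun _ => finite_iUnion fun _ => finite_iUnion fun h => h

lemma arrangementVertices_subset {ι : Type*} (p q : ι → E) :
    arrangementVertices p q ⊆ ⋃ j, segment ℝ (p j) (q j) := by
  rintro x ((⟨j, rfl⟩ | ⟨j, rfl⟩) | hx)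
  · exact mem_iUnion.2 ⟨j, left_mem_segment ℝ _ _⟩
  · exact mem_iUnion.2 ⟨j, right_mem_segment ℝ _ _⟩
  · simp only [mem_iUnion] at hx ⊢
    obtain ⟨i, -, -, h, -⟩ := hx
    exact ⟨i, h⟩

lemma exists_ne_mem_inter_of_notMem_arrangementVertices {ι : Type*} {p q : ι → E} {i j : ι} {x : E}
    (hx : x ∉ arrangementVertices p q) (hi : x ∈ segment ℝ (p i) (q i))
    (hj : x ∈ segment ℝ (p j) (q j)) :
    ∃ y ∈ segment ℝ (p i) (q i) ∩ segment ℝ (p j) (q j), x ≠ y := by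
  by_contra! h
  refine hx (Or.inr ?_)
  simp only [mem_iUnion]
  exact ⟨i, j, (finite_singleton x).subset fun y hy => (h y hy).symm, hi, hj⟩

/-- The pairs of (possibly equal) vertices which are consecutive on one of the segments. -/
def arrangementFaces {ι : Type*} [DecidableEq E] (p q : ι → E) : Set (Finset E) :=
  {s | ∃ a ∈ arrangementVertices p q, ∃ b ∈ arrangementVertices p q, s = {a, b} ∧
    (∃ j, segment ℝ a b ⊆ segment ℝ (p j) (q j)) ∧
    ∀ v ∈ arrangementVertices p q, v ∈ segment ℝ a b → v = a ∨ v = b}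

lemma singleton_mem_arrangementFaces {ι : Type*} [DecidableEq E] {p q : ι → E} {a : E}
    (ha : a ∈ arrangementVertices p q) : {a} ∈ arrangementFaces p q := by
  obtain ⟨j, hj⟩ := mem_iUnion.1 (arrangementVertices_subset p q ha)
  exact ⟨a, ha, a, ha, by simp, ⟨j, by simpa using hj⟩, by simp⟩

lemma finite_arrangementFaces {ι : Type*} [Finite ι] [DecidableEq E] (p q : ι → E) :
    (arrangementFaces p q).Finite := by
  refine ((finite_arrangementVertices p q).image2 (fun a b => ({a, b} : Finset E))
    (finite_arrangementVertices p q)).subset ?_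
  rintro _ ⟨a, ha, b, hb, rfl, -⟩
  exact mem_image2_of_mem ha hb

lemma convexHull_inter_subset_of_mem_arrangementFaces {ι : Type*} [DecidableEq E] {p q : ι → E}
    {s t : Finset E} (hs : s ∈ arrangementFaces p q) (ht : t ∈ arrangementFaces p q) :
    convexHull ℝ ↑s ∩ convexHull ℝ ↑t ⊆ convexHull ℝ (s ∩ t : Set E) := by
  obtain ⟨a, ha, b, hb, rfl, ⟨i, hi⟩, hab⟩ := hs
  obtain ⟨c, hc, d, hd, rfl, ⟨j, hj⟩, hcd⟩ := ht
  simp only [Finset.coe_pair, convexHull_pair]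
  rintro x ⟨hxab, hxcd⟩
  by_cases hx : x ∈ arrangementVertices p q
  · exact subset_convexHull ℝ _ ⟨hab x hx hxab, hcd x hx hxcd⟩
  obtain ⟨y, ⟨hyi, hyj⟩, hxy⟩ :=
    exists_ne_mem_inter_of_notMem_arrangementVertices hx (hi hxab) (hj hxcd)
  have hI := segment_subset_range_lineMap (hi hxab) hyi hxy
  have hJ := segment_subset_range_lineMap (hj hxcd) hyj hxy
  rw [pair_eq_pair_of_mem_segment hxy (hI (hi (left_mem_segment ℝ a b)))
    (hI (hi (right_mem_segment ℝ a b))) (hJ (hj (left_mem_segment ℝ c d)))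
    (hJ (hj (right_mem_segment ℝ c d))) hxab hxcd (ne_of_mem_of_not_mem ha hx).symm
    (ne_of_mem_of_not_mem hb hx).symm (ne_of_mem_of_not_mem hc hx).symm
    (ne_of_mem_of_not_mem hd hx).symm (hcd a ha) (hcd b hb) (hab c hc) (hab d hd),
    inter_self, convexHull_pair]
  exact hxcd

lemma affineIndependent_of_mem_arrangementFaces {ι : Type*} [DecidableEq E] {p q : ι → E}
    {s : Finset E} (hs : s ∈ arrangementFaces p q) : AffineIndependent ℝ ((↑) : s → E) := by
  obtain ⟨a, -, b, -, rfl, -⟩ := hs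
  change AffineIndependent ℝ ((↑) : ((({a, b} : Finset E) : Set E)) → E)
  rw [Finset.coe_pair]
  rcases eq_or_ne a b with rfl | hab
  · rw [pair_eq_singleton]
    exact affineIndependent_of_subsingleton ℝ _
  · have h := (affineIndependent_of_ne ℝ hab).range
    rwa [Matrix.range_cons_cons_empty] at h

/-- The complex of dimension at most one obtained by cutting segments at their endpoints and at
their isolated intersection points. -/
def arrangementComplex {ι : Type*} [DecidableEq E] (p q : ι → E) :
    Geometry.SimplicialComplex ℝ E where
  faces := arrangementFaces p q
  isRelLowerSet_faces := by
    rintro s ⟨a, ha, b, hb, rfl, h⟩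
    refine ⟨Finset.insert_nonempty _ _, fun t hts ht => ?_⟩
    have hcases : t = {a} ∨ t = {b} ∨ t = {a, b} := by
      rw [← Finset.coe_subset, Finset.coe_pair,
        (Finset.coe_nonempty.2 ht).subset_pair_iff_eq] at hts
      exact_mod_cast hts
    rcases hcases with rfl | rfl | rfl
    · exact singleton_mem_arrangementFaces ha
    · exact singleton_mem_arrangementFaces hb
    · exact ⟨a, ha, b, hb, rfl, h⟩
  indep := affineIndependent_of_mem_arrangementFaces
  inter_subset_convexHull := convexHull_inter_subset_of_mem_arrangementFaces

/-- Every point of one of the segments lies between two consecutive vertices. -/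
lemma exists_mem_arrangementFaces_of_mem_segment {ι : Type*} [Finite ι] [DecidableEq E]
    {p q : ι → E} {j : ι} {x : E} (hx : x ∈ segment ℝ (p j) (q j)) :
    ∃ s ∈ arrangementFaces p q, x ∈ convexHull ℝ (s : Set E) := by
  by_cases hxV : x ∈ arrangementVertices p q
  · exact ⟨{x}, singleton_mem_arrangementFaces hxV, by simp⟩
  set f : ℝ →ᵃ[ℝ] E := AffineMap.lineMap (p j) (q j) with hf
  have hpq : p j ≠ q j := by
    intro h
    rw [← h, segment_same, mem_singleton_iff] at hx
    exact hxV (hx ▸ Or.inl (Or.inl ⟨j, rfl⟩))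
  have hT : (f ⁻¹' arrangementVertices p q).Finite :=
    (finite_arrangementVertices p q).preimage (AffineMap.lineMap_injective ℝ hpq).injOn
  have h0 : f 0 ∈ arrangementVertices p q :=
    Or.inl (Or.inl ⟨j, by simp [hf]⟩)
  have h1 : f 1 ∈ arrangementVertices p q :=
    Or.inl (Or.inr ⟨j, by simp [hf]⟩)
  rw [segment_eq_image_lineMap] at hx
  obtain ⟨t, ⟨ht0, ht1⟩, rfl⟩ := hx
  obtain ⟨a, ⟨haV, hat⟩, ha⟩ := exists_max_image (f ⁻¹' arrangementVertices p q ∩ Iic t) id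
    (hT.subset inter_subset_left) ⟨0, h0, ht0⟩
  obtain ⟨b, ⟨hbV, hbt⟩, hb⟩ := exists_min_image (f ⁻¹' arrangementVertices p q ∩ Ici t) id
    (hT.subset inter_subset_left) ⟨1, h1, ht1⟩
  have hseg : segment ℝ (f a) (f b) = f '' Icc a b := by
    rw [← image_segment, segment_eq_Icc (le_trans hat hbt)]
  refine ⟨{f a, f b}, ⟨f a, haV, f b, hbV, rfl, ⟨j, ?_⟩, ?_⟩, ?_⟩
  · rw [hseg, segment_eq_image_lineMap]
    exact image_mono (Icc_subset_Icc (ha 0 ⟨h0, ht0⟩) (hb 1 ⟨h1, ht1⟩))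
  · rw [hseg]
    rintro _ hv ⟨r, ⟨har, hrb⟩, rfl⟩
    rcases le_total r t with h | h
    · exact Or.inl (congrArg f (le_antisymm (ha r ⟨hv, h⟩) har))
    · exact Or.inr (congrArg f (le_antisymm hrb (hb r ⟨hv, h⟩)))
  · rw [Finset.coe_pair, convexHull_pair, hseg]
    exact mem_image_of_mem f ⟨hat, hbt⟩

lemma space_arrangementComplex {ι : Type*} [Finite ι] [DecidableEq E] (p q : ι → E) :
    (arrangementComplex p q).space = ⋃ j, segment ℝ (p j) (q j) := by
  ext x
  rw [Geometry.SimplicialComplex.mem_space_iff, mem_iUnion]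
  constructor
  · rintro ⟨_, ⟨a, -, b, -, rfl, ⟨j, hj⟩, -⟩, hx⟩
    rw [Finset.coe_pair, convexHull_pair] at hx
    exact ⟨j, hj hx⟩
  · rintro ⟨j, hx⟩
    exact exists_mem_arrangementFaces_of_mem_segment hx

end SegmentArrangement

/-- For every finite collection of nondegenerate closed line segments in `ℝ³` there exists a
finite simplicial complex of dimension `≤ 1` whose underlying polyhedron is the union of the
segments. -/
theorem segments_admit_one_complex (m : ℕ) (p q : Fin m → E3) (hpq : ∀ j, p j ≠ q j) :
    ∃ X : Geometry.SimplicialComplex ℝ E3, X.faces.Finite ∧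
      (∀ s ∈ X.faces, s.card ≤ 2) ∧
      X.space = ⋃ j, segment ℝ (p j) (q j) := by
  classical
  refine ⟨arrangementComplex p q, finite_arrangementFaces p q, ?_, space_arrangementComplex p q⟩
  rintro _ ⟨a, -, b, -, rfl, -⟩
  exact Finset.card_le_two
end

section
/- Let aᵢ < bᵢ for i = 1, 2, 3 and let N = [a₁,b₁] × [a₂,b₂] × [a₃,b₃] ⊆ ℝ³. Let X be a finite simplicial complex of dimension ≤ 1 whose underlying polyhedron |X| is contained in the interior of N. Then there exists a finite simplicial complex H with underlying polyhedron |H| = N which contains a subcomplex K₁ of dimension ≤ 1 with |K₁| = |X|. -/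
open Set

namespace CellTriangulation

variable {E : Type*} [AddCommGroup E] [Module ℝ E]

/-- `y` lies in the closure of the cell of `x` in the arrangement of the zero sets of `F`. -/
def FaceLE (F : Finset (E →ᵃ[ℝ] ℝ)) (y x : E) : Prop :=
  ∀ g ∈ F, (0 < g y → 0 < g x) ∧ (g y < 0 → g x < 0)

/-- The set `P` contains at most one point of each cell of the arrangement of `F`. -/
def CellInjective (F : Finset (E →ᵃ[ℝ] ℝ)) (P : Set E) : Prop :=
  ∀ x ∈ P, ∀ y ∈ P, FaceLE F x y → FaceLE F y x → x = y

variable {F : Finset (E →ᵃ[ℝ] ℝ)} {P : Set E}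

lemma FaceLE.refl (x : E) : FaceLE F x x := fun _ _ => ⟨id, id⟩

lemma FaceLE.trans {x y z : E} (h : FaceLE F x y) (h' : FaceLE F y z) : FaceLE F x z :=
  fun g hg => ⟨fun k => (h' g hg).1 ((h g hg).1 k), fun k => (h' g hg).2 ((h g hg).2 k)⟩

lemma FaceLE.eq_zero {x y : E} (h : FaceLE F y x) {g : E →ᵃ[ℝ] ℝ} (hg : g ∈ F)
    (hx : g x = 0) : g y = 0 := by
  obtain ⟨h1, h2⟩ := h g hg
  by_contra hne
  rcases lt_or_gt_of_ne hne with h | h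
  · linarith [h2 h]
  · linarith [h1 h]

lemma affineMap_combo (g : E →ᵃ[ℝ] ℝ) {a b : ℝ} (hab : a + b = 1) (x y : E) :
    g (a • x + b • y) = a * g x + b * g y := by
  simpa using Convex.combo_affine_apply (f := g) (x := x) (y := y) hab

lemma convex_setOf_faceLE (m : E) : Convex ℝ {y | FaceLE F y m} := by
  intro y hy z hz a b ha hb hab g hg
  rw [affineMap_combo g hab]
  obtain ⟨hy1, hy2⟩ := hy g hg
  obtain ⟨hz1, hz2⟩ := hz g hg
  constructor
  · intro h
    by_contra hm
    have h1 : g y ≤ 0 := not_lt.1 fun k => hm (hy1 k)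
    have h2 : g z ≤ 0 := not_lt.1 fun k => hm (hz1 k)
    nlinarith [mul_nonneg ha (neg_nonneg.2 h1), mul_nonneg hb (neg_nonneg.2 h2)]
  · intro h
    by_contra hm
    have h1 : 0 ≤ g y := not_lt.1 fun k => hm (hy2 k)
    have h2 : 0 ≤ g z := not_lt.1 fun k => hm (hz2 k)
    nlinarith [mul_nonneg ha h1, mul_nonneg hb h2]

lemma faceLE_of_mem_convexHull {s : Set E} {m x : E} (hm : ∀ y ∈ s, FaceLE F y m)
    (hx : x ∈ convexHull ℝ s) : FaceLE F x m :=
  convexHull_min (t := {y | FaceLE F y m}) hm (convex_setOf_faceLE m) hx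

lemma eq_zero_of_mem_convexHull {s : Set E} {g : E →ᵃ[ℝ] ℝ} (h : ∀ y ∈ s, g y = 0) {x : E}
    (hx : x ∈ convexHull ℝ s) : g x = 0 := by
  refine convexHull_min (t := {y | g y = 0}) h ?_ hx
  intro y hy z hz a b _ _ hab
  simp only [mem_ofPred_eq] at hy hz ⊢
  rw [affineMap_combo g hab, hy, hz]
  simp

lemma exists_top {s : Finset E} (hs : s.Nonempty) (hc : IsChain (FaceLE F) (s : Set E)) :
    ∃ m ∈ s, ∀ y ∈ s, FaceLE F y m := by
  classical
  induction hs using Finset.Nonempty.cons_induction with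
  | singleton a => exact ⟨a, by simp, by simpa using FaceLE.refl a⟩
  | cons a s ha hs ih =>
    obtain ⟨m, hm, hmax⟩ := ih (hc.mono (by simp))
    have hne : a ≠ m := fun h => ha (h ▸ hm)
    rcases hc (by simp) (by simp [hm]) hne with h | h
    · refine ⟨m, by simp [hm], fun y hy => ?_⟩
      rcases Finset.mem_cons.1 hy with rfl | hy
      exacts [h, hmax y hy]
    · refine ⟨a, by simp, fun y hy => ?_⟩
      rcases Finset.mem_cons.1 hy with rfl | hy
      exacts [FaceLE.refl _, (hmax y hy).trans h]

lemma exists_separating [DecidableEq E] (hP : CellInjective F P) {s : Finset E}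
    (hsP : (s : Set E) ⊆ P) (hc : IsChain (FaceLE F) (s : Set E)) {m : E} (hm : m ∈ s)
    (hmax : ∀ y ∈ s, FaceLE F y m) (hne : (s.erase m).Nonempty) :
    ∃ g ∈ F, g m ≠ 0 ∧ ∀ y ∈ s.erase m, g y = 0 := by
  obtain ⟨n, hn, hnmax⟩ := exists_top hne (hc.mono (by simp))
  have hns := Finset.mem_of_mem_erase hn
  have hnot : ¬ FaceLE F m n := fun h =>
    Finset.ne_of_mem_erase hn (hP n (hsP hns) m (hsP hm) (hmax n hns) h)
  have hle := hmax n hns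
  simp only [FaceLE, not_forall] at hnot
  obtain ⟨g, hg, hgn⟩ := hnot
  obtain ⟨h1, h2⟩ := hle g hg
  have hgm : g m ≠ 0 := fun h => hgn (by simp [h])
  refine ⟨g, hg, hgm, fun y hy => (hnmax y hy).eq_zero hg ?_⟩
  by_contra h0
  apply hgn
  rcases lt_or_gt_of_ne h0 with h | h
  · exact ⟨fun k => absurd (h2 h) (not_lt.2 k.le), fun _ => h⟩
  · exact ⟨fun _ => h, fun k => absurd (h1 h) (not_lt.2 k.le)⟩

lemma affineIndependent_of_isChain (hP : CellInjective F P) (s : Finset E)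
    (hsP : (s : Set E) ⊆ P) (hc : IsChain (FaceLE F) (s : Set E)) :
    AffineIndependent ℝ ((↑) : s → E) := by
  classical
  induction hn : s.card generalizing s with
  | zero =>
    rw [Finset.card_eq_zero] at hn
    subst hn
    exact affineIndependent_of_subsingleton ℝ _
  | succ n ih =>
    have hs : s.Nonempty := Finset.card_pos.1 (by omega)
    obtain ⟨m, hm, hmax⟩ := exists_top hs hc
    have hsub : ((s.erase m : Finset E) : Set E) ⊆ s := by simp
    have hi := ih (s.erase m) (hsub.trans hsP) (hc.mono hsub)
      (by rw [Finset.card_erase_of_mem hm]; omega)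
    rcases (s.erase m).eq_empty_or_nonempty with he | hne
    · have : s.card ≤ 1 := by
        have := Finset.card_erase_of_mem hm
        rw [he] at this
        simp at this
        omega
      have : Subsingleton s := by
        rw [← Fintype.card_le_one_iff_subsingleton]; simpa using this
      exact affineIndependent_of_subsingleton ℝ _
    · obtain ⟨g, hg, hgm, hg0⟩ := exists_separating hP hsP hc hm hmax hne
      have hspan : m ∉ affineSpan ℝ ((s.erase m : Finset E) : Set E) := by
        intro hmem
        have : g m ∈ (affineSpan ℝ ((s.erase m : Finset E) : Set E)).map g :=
          ⟨m, hmem, rfl⟩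
        rw [AffineSubspace.map_span] at this
        have h2 : g '' ((s.erase m : Finset E) : Set E) ⊆ {0} := by
          rintro _ ⟨y, hy, rfl⟩
          exact hg0 y hy
        have h3 := affineSpan_mono ℝ h2 this
        exact hgm (by simpa using h3)
      refine AffineIndependent.affineIndependent_of_notMem_span (i := ⟨m, hm⟩) ?_ ?_
      · exact hi.comp_embedding ⟨fun x : {y : s // y ≠ ⟨m, hm⟩} => ⟨x.1.1, Finset.mem_erase.2
          ⟨fun h => x.2 (Subtype.ext h), x.1.2⟩⟩, fun x y hxy =>
            Subtype.ext (Subtype.ext (Subtype.mk.inj hxy))⟩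
      · refine fun h => hspan (affineSpan_mono ℝ ?_ h)
        rintro _ ⟨x, hx, rfl⟩
        exact Finset.mem_erase.2 ⟨fun h => hx (Subtype.ext h), x.2⟩

lemma mem_convexHull_cases [DecidableEq E] {s : Finset E} {m x : E} (hm : m ∈ s)
    (hx : x ∈ convexHull ℝ (s : Set E)) :
    x = m ∨ ∃ y ∈ convexHull ℝ ((s.erase m : Finset E) : Set E), ∃ w : ℝ, 0 ≤ w ∧ w ≤ 1 ∧
      x = w • m + (1 - w) • y := by
  rcases (s.erase m).eq_empty_or_nonempty with he | hne
  · left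
    have : s = {m} := by rw [← Finset.insert_erase hm, he]; rfl
    simpa [this] using hx
  · right
    rw [← Finset.insert_erase hm, Finset.coe_insert,
      convexHull_insert (Finset.coe_nonempty.2 hne), mem_convexJoin] at hx
    obtain ⟨a, ha, y, hy, hxy⟩ := hx
    rw [mem_singleton_iff] at ha
    subst ha
    obtain ⟨u, v, hu, hv, huv, rfl⟩ := hxy
    exact ⟨y, hy, u, hu, by linarith, by rw [← huv]; simp⟩

lemma faceLE_of_combo {m y : E} (h : FaceLE F y m) {w : ℝ} (hw : 0 < w) (hw1 : w ≤ 1) :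
    FaceLE F m (w • m + (1 - w) • y) := by
  intro g hg
  rw [affineMap_combo g (by ring)]
  obtain ⟨h1, h2⟩ := h g hg
  constructor
  · intro hm
    have hy : 0 ≤ g y := not_lt.1 fun k => by linarith [h2 k]
    nlinarith [mul_pos hw hm, mul_nonneg (sub_nonneg.2 hw1) hy]
  · intro hm
    have hy : g y ≤ 0 := not_lt.1 fun k => by linarith [h1 k]
    nlinarith [mul_pos hw (neg_pos.2 hm), mul_nonneg (sub_nonneg.2 hw1) (neg_nonneg.2 hy)]

lemma weight_le {m y z : E} (hz : FaceLE F z m) {g : E →ᵃ[ℝ] ℝ} (hg : g ∈ F) (hgm : g m ≠ 0)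
    (hgy : g y = 0) {v w : ℝ} (hw1 : w ≤ 1)
    (h : v • m + (1 - v) • y = w • m + (1 - w) • z) : w ≤ v := by
  have key := congrArg g h
  rw [affineMap_combo g (by ring), affineMap_combo g (by ring), hgy] at key
  obtain ⟨h1, h2⟩ := hz g hg
  by_contra! hlt
  rcases lt_or_gt_of_ne hgm with hm | hm
  · have hz0 : g z ≤ 0 := not_lt.1 fun k => by linarith [h1 k]
    nlinarith [mul_pos (sub_pos.2 hlt) (neg_pos.2 hm),
      mul_nonneg (sub_nonneg.2 hw1) (neg_nonneg.2 hz0)]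
  · have hz0 : 0 ≤ g z := not_lt.1 fun k => by linarith [h2 k]
    nlinarith [mul_pos (sub_pos.2 hlt) hm, mul_nonneg (sub_nonneg.2 hw1) hz0]

lemma convexHull_inter_subset_of_isChain (hP : CellInjective F P) (s t : Finset E)
    (hsP : (s : Set E) ⊆ P) (hs : IsChain (FaceLE F) (s : Set E))
    (htP : (t : Set E) ⊆ P) (ht : IsChain (FaceLE F) (t : Set E)) :
    convexHull ℝ (s : Set E) ∩ convexHull ℝ (t : Set E) ⊆ convexHull ℝ (s ∩ t : Set E) := by
  classical
  induction hn : s.card + t.card using Nat.strong_induction_on generalizing s t with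
  | _ n ih =>
  rintro x ⟨hxs, hxt⟩
  have hsne : s.Nonempty := Finset.coe_nonempty.1 (convexHull_nonempty_iff.1 ⟨x, hxs⟩)
  have htne : t.Nonempty := Finset.coe_nonempty.1 (convexHull_nonempty_iff.1 ⟨x, hxt⟩)
  obtain ⟨m, hm, hmmax⟩ := exists_top hsne hs
  obtain ⟨k, hk, hkmax⟩ := exists_top htne ht
  have hs' : ((s.erase m : Finset E) : Set E) ⊆ s := by simp
  have ht' : ((t.erase k : Finset E) : Set E) ⊆ t := by simp
  have hcs := Finset.card_erase_lt_of_mem hm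
  have hct := Finset.card_erase_lt_of_mem hk
  by_cases hxs' : x ∈ convexHull ℝ ((s.erase m : Finset E) : Set E)
  · exact convexHull_mono (inter_subset_inter_left _ hs')
      (ih _ (by omega) (s.erase m) t (hs'.trans hsP) (hs.mono hs') htP ht rfl ⟨hxs', hxt⟩)
  by_cases hxt' : x ∈ convexHull ℝ ((t.erase k : Finset E) : Set E)
  · exact convexHull_mono (inter_subset_inter_right _ ht')
      (ih _ (by omega) s (t.erase k) hsP hs (ht'.trans htP) (ht.mono ht') rfl ⟨hxs, hxt'⟩)
  have top_le : ∀ (r : Finset E) (q : E), q ∈ r → (∀ y ∈ r, FaceLE F y q) →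
      x ∈ convexHull ℝ (r : Set E) → x ∉ convexHull ℝ ((r.erase q : Finset E) : Set E) →
      x = q ∨ ∃ y ∈ convexHull ℝ ((r.erase q : Finset E) : Set E), ∃ w : ℝ, 0 < w ∧ w ≤ 1 ∧
        x = w • q + (1 - w) • y ∧ FaceLE F y q ∧ FaceLE F q x := by
    intro r q hq hqmax hxr hxr'
    rcases mem_convexHull_cases hq hxr with h | ⟨y, hy, w, hw0, hw1, hxw⟩
    · exact Or.inl h
    · have hw : 0 < w := by
        refine lt_of_le_of_ne hw0 fun h => hxr' ?_
        rw [hxw, ← h]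
        simpa using hy
      have hyq : FaceLE F y q :=
        faceLE_of_mem_convexHull (fun z hz => hqmax z (Finset.mem_of_mem_erase hz)) hy
      exact Or.inr ⟨y, hy, w, hw, hw1, hxw, hyq, hxw ▸ faceLE_of_combo hyq hw hw1⟩
  have hxm := faceLE_of_mem_convexHull hmmax hxs
  have hxk := faceLE_of_mem_convexHull hkmax hxt
  have hs2 := top_le s m hm hmmax hxs hxs'
  have ht2 := top_le t k hk hkmax hxt hxt'
  have hmx : FaceLE F m x := by
    rcases hs2 with h | ⟨_, _, _, _, _, _, _, h⟩
    exacts [h ▸ FaceLE.refl _, h]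
  have hkx : FaceLE F k x := by
    rcases ht2 with h | ⟨_, _, _, _, _, _, _, h⟩
    exacts [h ▸ FaceLE.refl _, h]
  obtain rfl : m = k := hP m (hsP hm) k (htP hk) (hmx.trans hxk) (hkx.trans hxm)
  have hmst : m ∈ convexHull ℝ (s ∩ t : Set E) := subset_convexHull ℝ _ ⟨hm, hk⟩
  rcases hs2 with rfl | ⟨y, hy, v, hv, hv1, hxv, hym, -⟩
  · exact hmst
  rcases ht2 with rfl | ⟨z, hz, w, hw, hw1, hxw, hzm, -⟩
  · exact hmst
  have hvw : v • m + (1 - v) • y = w • m + (1 - w) • z := hxv.symm.trans hxw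
  have sep : ∀ (r : Finset E) (u : E), (r : Set E) ⊆ P → IsChain (FaceLE F) (r : Set E) →
      m ∈ r → (∀ y ∈ r, FaceLE F y m) → u ∈ convexHull ℝ ((r.erase m : Finset E) : Set E) →
      ∃ g ∈ F, g m ≠ 0 ∧ g u = 0 := by
    intro r u hrP hr hmr hmax hu
    obtain ⟨g, hg, hgm, hg0⟩ := exists_separating hP hrP hr hmr hmax
      (Finset.coe_nonempty.1 (convexHull_nonempty_iff.1 ⟨u, hu⟩))
    exact ⟨g, hg, hgm, eq_zero_of_mem_convexHull hg0 hu⟩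
  obtain ⟨g, hg, hgm, hgy⟩ := sep s y hsP hs hm hmmax hy
  obtain ⟨g', hg', hgm', hgz⟩ := sep t z htP ht hk hkmax hz
  obtain rfl : v = w := le_antisymm (weight_le hym hg' hgm' hgz hv1 hvw.symm)
    (weight_le hzm hg hgm hgy hw1 hvw)
  rcases hv1.eq_or_lt with rfl | hv1'
  · simpa [hxv] using hmst
  have hyz : y = z := smul_right_injective E (sub_pos.2 hv1').ne' (add_left_cancel hvw)
  subst hyz
  have hyst := convexHull_mono (inter_subset_inter hs' ht')
    (ih _ (by omega) (s.erase m) (t.erase m) (hs'.trans hsP) (hs.mono hs') (ht'.trans htP)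
      (ht.mono ht') rfl ⟨hy, hz⟩)
  rw [hxv]
  exact convex_convexHull ℝ _ hmst hyst hv.le (by linarith) (by ring)

/-- The complex of chains of cells with representatives in `P ∩ A`: the part in `A` of the
derived subdivision of the arrangement of `F` at the points of `P`. -/
def chainComplex (hP : CellInjective F P) (A : Set E) : Geometry.SimplicialComplex ℝ E where
  faces := {s | s.Nonempty ∧ (s : Set E) ⊆ P ∩ A ∧ IsChain (FaceLE F) (s : Set E)}
  isRelLowerSet_faces := by
    rintro s ⟨hs, hsA, hc⟩
    exact ⟨hs, fun t hts ht =>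
      ⟨ht, (Finset.coe_subset.2 hts).trans hsA, hc.mono (Finset.coe_subset.2 hts)⟩⟩
  indep := fun hs => affineIndependent_of_isChain hP _ (hs.2.1.trans inter_subset_left) hs.2.2
  inter_subset_convexHull := fun hs ht =>
    convexHull_inter_subset_of_isChain hP _ _ (hs.2.1.trans inter_subset_left) hs.2.2
      (ht.2.1.trans inter_subset_left) ht.2.2

/-- Moving from `p` through another point `x` of the same cell, one reaches a boundary point. -/
lemma exists_boundary_point {p x : E} (hpx : FaceLE F p x) (hxp : FaceLE F x p)
    (hF : ∃ g ∈ F, 0 < g p ∧ g x < g p) :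
    ∃ y, FaceLE F y p ∧ x ∈ segment ℝ p y ∧ ∃ g ∈ F, g p ≠ 0 ∧ g y = 0 := by
  classical
  let S := F.filter fun g => (0 < g p ∧ g x < g p) ∨ (g p < 0 ∧ g p < g x)
  have hS : S.Nonempty := by
    obtain ⟨g, hg, h⟩ := hF
    exact ⟨g, by simp [S, hg, h]⟩
  obtain ⟨g₀, hg₀, hmin⟩ := S.exists_min_image (fun g => g p / (g p - g x)) hS
  obtain ⟨hg₀F, hg₀S⟩ := Finset.mem_filter.1 hg₀
  set t := g₀ p / (g₀ p - g₀ x) with ht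
  have ht1 : 1 ≤ t := by
    rcases hg₀S with ⟨h1, h2⟩ | ⟨h1, h2⟩
    · have := (hpx g₀ hg₀F).1 h1
      rw [ht, one_le_div (by linarith)]
      linarith
    · have := (hpx g₀ hg₀F).2 h1
      rw [ht, one_le_div_of_neg (by linarith)]
      linarith
  have ht0 : 0 < t := by linarith
  have hval : ∀ g : E →ᵃ[ℝ] ℝ, g ((1 - t) • p + t • x) = (1 - t) * g p + t * g x :=
    fun g => affineMap_combo g (by ring) _ _
  refine ⟨(1 - t) • p + t • x, fun g hg => ?_, ?_, g₀, hg₀F, ?_, ?_⟩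
  · rw [hval]
    constructor
    · intro h
      by_contra! hp
      rcases hp.eq_or_lt with hp | hp
      · rw [hp, hxp.eq_zero hg hp] at h
        simp at h
      · rcases le_or_gt (g x) (g p) with hle | hgt
        · nlinarith
        · have := hmin g (by simp [S, hg, hp, hgt])
          rw [le_div_iff_of_neg (by linarith)] at this
          nlinarith
    · intro h
      by_contra! hp
      rcases hp.eq_or_lt with hp | hp
      · rw [← hp, hxp.eq_zero hg hp.symm] at h
        simp at h
      · rcases le_or_gt (g p) (g x) with hle | hgt
        · nlinarith
        · have := hmin g (by simp [S, hg, hp, hgt])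
          rw [le_div_iff₀ (by linarith)] at this
          nlinarith
  · refine ⟨1 - t⁻¹, t⁻¹, sub_nonneg.2 (inv_le_one_of_one_le₀ ht1), by positivity, by ring, ?_⟩
    rw [smul_add, smul_smul, smul_smul, inv_mul_cancel₀ ht0.ne', one_smul, ← add_assoc,
      ← add_smul, mul_sub, inv_mul_cancel₀ ht0.ne']
    simp
  · rcases hg₀S with h | h
    exacts [h.1.ne', h.1.ne]
  · have hne : g₀ p - g₀ x ≠ 0 := by
      rcases hg₀S with h | h
      · exact (sub_pos.2 h.2).ne'
      · exact (sub_neg.2 h.2).ne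
    rw [hval, ht]
    field_simp
    ring

lemma exists_chain_mem_convexHull {N : Set E} (hrep : ∀ x, ∃ p ∈ P, FaceLE F p x ∧ FaceLE F x p)
    (hN : ∀ x ∈ N, ∀ y, FaceLE F y x → y ∈ N)
    (hF : ∀ x ∈ N, ∀ y ∈ N, x ≠ y → ∃ g ∈ F, 0 < g y ∧ g x < g y) (x : E) (hx : x ∈ N) :
    ∃ s : Finset E, (s : Set E) ⊆ P ∧ IsChain (FaceLE F) (s : Set E) ∧
      (∀ y ∈ s, FaceLE F y x) ∧ x ∈ convexHull ℝ (s : Set E) := by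
  classical
  induction hn : (F.filter fun g => g x ≠ 0).card using Nat.strong_induction_on
    generalizing x with
  | _ n ih =>
  obtain ⟨p, hpP, hpx, hxp⟩ := hrep x
  by_cases hne : x = p
  · subst hne
    exact ⟨{x}, by simpa, by simp [IsChain], by simpa using hpx, by simp⟩
  obtain ⟨y, hyp, hxy, g, hg, hgp, hgy⟩ :=
    exists_boundary_point hpx hxp (hF x hx p (hN x hx p hpx) hne)
  have hyx := hyp.trans hpx
  have hlt : (F.filter fun g => g y ≠ 0).card < n := by
    rw [← hn]
    refine Finset.card_lt_card (Finset.ssubset_iff_of_subset ?_ |>.2 ⟨g, ?_, ?_⟩)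
    · intro f hf
      simp only [Finset.mem_filter] at hf ⊢
      exact ⟨hf.1, fun h => hf.2 (hyx.eq_zero hf.1 h)⟩
    · simp only [Finset.mem_filter]
      exact ⟨hg, fun h => hgp (hpx.eq_zero hg h)⟩
    · simp [hgy]
  obtain ⟨s, hsP, hsc, hsy, hys⟩ := ih _ hlt y (hN x hx y hyx) rfl
  refine ⟨insert p s, ?_, ?_, ?_, ?_⟩
  · rw [Finset.coe_insert]
    exact insert_subset hpP hsP
  · rw [Finset.coe_insert]
    exact hsc.insert fun b hb _ => Or.inr ((hsy b hb).trans hyp)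
  · intro z hz
    rcases Finset.mem_insert.1 hz with rfl | hz
    exacts [hpx, (hsy z hz).trans hyx]
  · rw [Finset.coe_insert]
    exact (convex_convexHull ℝ _).segment_subset (subset_convexHull ℝ _ (mem_insert _ _))
      (convexHull_mono (subset_insert _ _) hys) hxy

lemma exists_cell_representatives (F : Finset (E →ᵃ[ℝ] ℝ)) :
    ∃ P : Set E, P.Finite ∧ CellInjective F P ∧
      ∀ x, ∃ p ∈ P, FaceLE F p x ∧ FaceLE F x p := by
  let sgn : E → F → SignType := fun x g => SignType.sign (g.1 x)
  have hle : ∀ {x y}, sgn x = sgn y → FaceLE F x y := by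
    intro x y h g hg
    have := congrFun h ⟨g, hg⟩
    simp only [sgn] at this
    constructor
    · intro hx
      rwa [← sign_eq_one_iff, ← this, sign_eq_one_iff]
    · intro hx
      rwa [← sign_eq_neg_one_iff, ← this, sign_eq_neg_one_iff]
  have hinv : ∀ x, sgn (Function.invFun sgn (sgn x)) = sgn x :=
    fun x => Function.invFun_eq ⟨x, rfl⟩
  refine ⟨range fun x => Function.invFun sgn (sgn x), ?_, ?_, fun x =>
    ⟨_, ⟨x, rfl⟩, hle (hinv x), hle (hinv x).symm⟩⟩
  · exact (finite_range (Function.invFun sgn)).subset (range_subset_iff.2 fun x => mem_range_self _)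
  · rintro _ ⟨x, rfl⟩ _ ⟨y, rfl⟩ hxy hyx
    have : sgn x = sgn y := by
      rw [← hinv x, ← hinv y]
      funext g
      obtain ⟨h1, h2⟩ := hxy g g.2
      obtain ⟨h3, h4⟩ := hyx g g.2
      simp only [sgn] at h1 h2 h3 h4 ⊢
      rcases lt_trichotomy (g.1 (Function.invFun sgn (sgn x))) 0 with h | h | h
      · rw [sign_neg h, sign_neg (h2 h)]
      · rw [h, sign_zero, eq_comm, sign_eq_zero_iff]
        by_contra h0
        rcases lt_or_gt_of_ne h0 with h0 | h0
        · linarith [h4 h0]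
        · linarith [h3 h0]
      · rw [sign_pos h, sign_pos (h1 h)]
    simp only [this]

lemma mem_halfspaces_of_faceLE {G : Finset (E →ᵃ[ℝ] ℝ)} (hG : G ⊆ F) {x y : E}
    (hyx : FaceLE F y x) (hx : ∀ g ∈ G, 0 ≤ g x) : ∀ g ∈ G, 0 ≤ g y := by
  intro g hg
  by_contra! h
  linarith [(hyx g (hG hg)).2 h, hx g hg]

/-- The affine functional `x ↦ c * x i + d * x j + e`. -/
noncomputable def coordFunctional {ι : Type*} (i j : ι) (c d e : ℝ) : (ι → ℝ) →ᵃ[ℝ] ℝ :=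
  (c • LinearMap.proj i + d • LinearMap.proj j : (ι → ℝ) →ₗ[ℝ] ℝ).toAffineMap +
    AffineMap.const ℝ (ι → ℝ) e

@[simp]
lemma coordFunctional_apply {ι : Type*} (i j : ι) (c d e : ℝ) (x : ι → ℝ) :
    coordFunctional i j c d e x = c * x i + d * x j + e := by
  simp [coordFunctional]

lemma exists_halfspaces_box {ι : Type*} [Fintype ι] (a b : ι → ℝ) :
    ∃ G : Finset ((ι → ℝ) →ᵃ[ℝ] ℝ),
      (∀ x, x ∈ univ.pi (fun i => Icc (a i) (b i)) ↔ ∀ g ∈ G, 0 ≤ g x) ∧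
      ∀ x y : ι → ℝ, x ≠ y → ∃ g ∈ G, g x < g y := by
  classical
  refine ⟨Finset.univ.image (fun i => coordFunctional i i 1 0 (-a i)) ∪
    Finset.univ.image (fun i => coordFunctional i i (-1) 0 (b i)), fun x => ?_, fun x y hxy => ?_⟩
  · simp only [mem_univ_pi, mem_Icc, Finset.mem_union, Finset.mem_image, Finset.mem_univ,
      true_and, or_imp, forall_and, forall_exists_index, forall_apply_eq_imp_iff,
      coordFunctional_apply]
    refine and_congr (forall_congr' fun i => ?_) (forall_congr' fun i => ?_) <;>
      constructor <;> intro h <;> linarith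
  · obtain ⟨i, hi⟩ := Function.ne_iff.1 hxy
    rcases lt_or_gt_of_ne hi with h | h
    · exact ⟨coordFunctional i i 1 0 (-a i), by simp, by simpa using h⟩
    · exact ⟨coordFunctional i i (-1) 0 (b i), by simp, by
        simp only [coordFunctional_apply]
        linarith⟩

lemma exists_halfspaces_segment {ι : Type*} [Fintype ι] (u v : ι → ℝ) :
    ∃ G : Finset ((ι → ℝ) →ᵃ[ℝ] ℝ), ∀ x, x ∈ segment ℝ u v ↔ ∀ g ∈ G, 0 ≤ g x := by
  classical
  obtain ⟨B, hB, -⟩ := exists_halfspaces_box (u ⊓ v) (u ⊔ v)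
  let C : Finset ((ι → ℝ) →ᵃ[ℝ] ℝ) := Finset.univ.image fun k : ι × ι =>
    coordFunctional k.2 k.1 (v k.1 - u k.1) (-(v k.2 - u k.2))
      (-(v k.1 - u k.1) * u k.2 + (v k.2 - u k.2) * u k.1)
  refine ⟨B ∪ C, fun x => ?_⟩
  have hC : (∀ g ∈ C, 0 ≤ g x) ↔
      ∀ i j, (v j - u j) * (x i - u i) ≤ (v i - u i) * (x j - u j) := by
    simp only [C, Finset.mem_image, Finset.mem_univ, true_and, forall_exists_index,
      forall_apply_eq_imp_iff, coordFunctional_apply]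
    rw [Prod.forall]
    refine forall_congr' fun i => forall_congr' fun j => ?_
    constructor <;> intro h <;> linarith
  have hBC : (∀ g ∈ B ∪ C, 0 ≤ g x) ↔ (∀ g ∈ B, 0 ≤ g x) ∧ ∀ g ∈ C, 0 ≤ g x := by
    simp only [Finset.mem_union, or_imp, forall_and]
  rw [hBC, ← hB, hC]
  simp only [mem_univ_pi, mem_Icc, Pi.inf_apply, Pi.sup_apply]
  constructor
  · rintro ⟨c, d, hc, hd, hcd, rfl⟩
    obtain rfl : c = 1 - d := by linarith
    refine ⟨fun i => ?_, fun i j => ?_⟩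
    · have := convex_Icc (u i ⊓ v i) (u i ⊔ v i) (x := u i) ⟨inf_le_left, le_sup_left⟩
        (y := v i) ⟨inf_le_right, le_sup_right⟩ hc hd hcd
      simpa using this
    · apply le_of_eq
      simp
      ring
  · rintro ⟨hbox, hcross⟩
    by_cases huv : u = v
    · subst huv
      have : x = u := by
        funext i
        have := hbox i
        simp only [inf_idem, sup_idem] at this
        exact le_antisymm this.2 this.1
      rw [this]
      exact left_mem_segment ℝ u u
    obtain ⟨i, hi⟩ := Function.ne_iff.1 huv
    have hd : v i - u i ≠ 0 := sub_ne_zero.2 (Ne.symm hi)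
    rw [segment_eq_image']
    refine ⟨(x i - u i) / (v i - u i), ?_, ?_⟩
    · obtain ⟨h1, h2⟩ := hbox i
      rcases lt_or_gt_of_ne hi with h | h
      · rw [inf_eq_left.2 h.le] at h1
        rw [sup_eq_right.2 h.le] at h2
        exact ⟨div_nonneg (by linarith) (by linarith), (div_le_one (by linarith)).2 (by linarith)⟩
      · rw [inf_eq_right.2 h.le] at h1
        rw [sup_eq_left.2 h.le] at h2
        exact ⟨div_nonneg_of_nonpos (by linarith) (by linarith),
          (div_le_one_of_neg (by linarith)).2 (by linarith)⟩
    · funext j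
      have := le_antisymm (hcross i j) (hcross j i)
      simp only [Pi.add_apply, Pi.smul_apply, Pi.sub_apply, smul_eq_mul]
      field_simp
      linarith

lemma exists_halfspaces_convexHull {ι : Type*} [Fintype ι] {s : Finset (ι → ℝ)}
    (hs : s.Nonempty) (hcard : s.card ≤ 2) :
    ∃ G : Finset ((ι → ℝ) →ᵃ[ℝ] ℝ),
      ∀ x, x ∈ convexHull ℝ (s : Set (ι → ℝ)) ↔ ∀ g ∈ G, 0 ≤ g x := by
  classical
  have hpos := hs.card_pos
  obtain ⟨u, v, rfl⟩ : ∃ u v, s = {u, v} := by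
    rcases (by omega : s.card = 1 ∨ s.card = 2) with h | h
    · obtain ⟨u, rfl⟩ := Finset.card_eq_one.1 h
      exact ⟨u, u, by simp⟩
    · obtain ⟨u, v, -, rfl⟩ := Finset.card_eq_two.1 h
      exact ⟨u, v, rfl⟩
  simpa [convexHull_pair] using exists_halfspaces_segment u v

end CellTriangulation

open CellTriangulation in
/-- Let `N = [a₁,b₁] × [a₂,b₂] × [a₃,b₃] ⊆ ℝ³` with `aᵢ < bᵢ`, and let `X` be a finite simplicial
complex of dimension `≤ 1` with `|X| ⊆ interior N`.  Then there is a finite simplicial complex `H`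
with `|H| = N` containing a subcomplex `K₁` of dimension `≤ 1` with `|K₁| = |X|`. -/
theorem box_triangulation_containing_one_complex (a b : Fin 3 → ℝ) (hab : ∀ i, a i < b i)
    (X : Geometry.SimplicialComplex ℝ E3) (hXfin : X.faces.Finite)
    (hXdim : ∀ s ∈ X.faces, s.card ≤ 2)
    (hXsub : X.space ⊆ interior (Set.univ.pi fun i => Set.Icc (a i) (b i))) :
    ∃ H : Geometry.SimplicialComplex ℝ E3, H.faces.Finite ∧
      H.space = (Set.univ.pi fun i => Set.Icc (a i) (b i)) ∧
      ∃ K₁ : Geometry.SimplicialComplex ℝ E3, K₁.faces ⊆ H.faces ∧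
        (∀ s ∈ K₁.faces, s.card ≤ 2) ∧ K₁.space = X.space := by
  classical
  set N : Set E3 := Set.univ.pi fun i => Set.Icc (a i) (b i)
  have hXN : X.space ⊆ N := hXsub.trans interior_subset
  obtain ⟨B, hB, hBsep⟩ := exists_halfspaces_box a b
  have hG : ∀ s : X.faces, ∃ G : Finset (E3 →ᵃ[ℝ] ℝ),
      ∀ x, x ∈ convexHull ℝ (s.1 : Set E3) ↔ ∀ g ∈ G, 0 ≤ g x := fun s =>
    exists_halfspaces_convexHull (X.nonempty_of_mem_faces s.2) (hXdim s.1 s.2)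
  choose G hG using hG
  have : Fintype X.faces := hXfin.fintype
  let F : Finset (E3 →ᵃ[ℝ] ℝ) := B ∪ Finset.univ.biUnion G
  have hBF : B ⊆ F := Finset.subset_union_left
  have hGF : ∀ s, G s ⊆ F := fun s =>
    (Finset.subset_biUnion_of_mem G (Finset.mem_univ s)).trans Finset.subset_union_right
  obtain ⟨P, hPfin, hP, hrep⟩ := exists_cell_representatives F
  have hNdown : ∀ x ∈ N, ∀ y, FaceLE F y x → y ∈ N := fun x hx y hyx =>
    (hB y).2 (mem_halfspaces_of_faceLE hBF hyx ((hB x).1 hx))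
  have hsdown : ∀ s ∈ X.faces, ∀ x ∈ convexHull ℝ (s : Set E3), ∀ y, FaceLE F y x →
      y ∈ convexHull ℝ (s : Set E3) := fun s hs x hx y hyx =>
    (hG ⟨s, hs⟩ y).2 (mem_halfspaces_of_faceLE (hGF ⟨s, hs⟩) hyx ((hG ⟨s, hs⟩ x).1 hx))
  have hchain := exists_chain_mem_convexHull hrep hNdown (fun x hx y _ hxy => by
    obtain ⟨g, hg, hlt⟩ := hBsep x y hxy
    exact ⟨g, hBF hg, ((hB x).1 hx g hg).trans_lt hlt, hlt⟩)
  have hface : ∀ t ∈ (chainComplex hP X.space).faces, ∃ s ∈ X.faces,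
      (t : Set E3) ⊆ convexHull ℝ (s : Set E3) := by
    rintro t ⟨htne, htX, htc⟩
    obtain ⟨m, hm, hmax⟩ := exists_top htne htc
    obtain ⟨s, hs, hms⟩ := Geometry.SimplicialComplex.mem_space_iff.1 (htX hm).2
    exact ⟨s, hs, fun y hy => hsdown s hs m hms y (hmax y hy)⟩
  refine ⟨chainComplex hP N, ?_, ?_, chainComplex hP X.space, ?_, ?_, ?_⟩
  · refine (hPfin.toFinset.powerset.finite_toSet).subset ?_
    rintro s ⟨-, hs, -⟩
    simpa using hs.trans inter_subset_left
  · ext x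
    rw [Geometry.SimplicialComplex.mem_space_iff]
    constructor
    · rintro ⟨s, ⟨-, hs, -⟩, hx⟩
      exact convexHull_min (hs.trans inter_subset_right)
        (convex_pi fun i _ => convex_Icc (a i) (b i)) hx
    · intro hx
      obtain ⟨s, hsP, hsc, hsx, hxs⟩ := hchain x hx
      exact ⟨s, ⟨Finset.coe_nonempty.1 (convexHull_nonempty_iff.1 ⟨x, hxs⟩),
        fun y hy => ⟨hsP hy, hNdown x hx y (hsx y hy)⟩, hsc⟩, hxs⟩
  · rintro s ⟨hs, hsX, hsc⟩
    exact ⟨hs, hsX.trans (inter_subset_inter_right _ hXN), hsc⟩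
  · intro t ht
    obtain ⟨s, hs, hts⟩ := hface t ht
    have hspan := hts.trans (convexHull_subset_affineSpan (s : Set E3))
    have hind := (chainComplex hP X.space).indep ht
    exact (hind.card_le_card_of_subset_affineSpan hspan).trans (hXdim s hs)
  · ext x
    rw [Geometry.SimplicialComplex.mem_space_iff]
    constructor
    · rintro ⟨t, ht, hx⟩
      obtain ⟨s, hs, hts⟩ := hface t ht
      exact X.convexHull_subset_space hs (convexHull_min hts (convex_convexHull ℝ _) hx)
    · intro hx
      obtain ⟨s, hsP, hsc, hsx, hxs⟩ := hchain x (hXN hx)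
      obtain ⟨r, hr, hxr⟩ := Geometry.SimplicialComplex.mem_space_iff.1 hx
      exact ⟨s, ⟨Finset.coe_nonempty.1 (convexHull_nonempty_iff.1 ⟨x, hxs⟩), fun y hy =>
        ⟨hsP hy, X.convexHull_subset_space hr (hsdown r hr x hxr y (hsx y hy))⟩, hsc⟩, hxs⟩
end

section
/- If f : ℝ → ℂ is almost periodic and vanishes at infinity, then f is identically zero. -/
open Filter

/-- A trigonometric polynomial: a finite linear combination of the exponentials
`x ↦ exp(iμx)`, `μ ∈ ℝ`. -/
def IsTrigPoly (g : ℝ → ℂ) : Prop :=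
  ∃ (m : ℕ) (c : Fin m → ℂ) (μ : Fin m → ℝ),
    ∀ x : ℝ, g x = ∑ i, c i * Complex.exp (Complex.I * (μ i : ℂ) * (x : ℂ))

/-- `f : ℝ → ℂ` is almost periodic if it is a uniform limit on `ℝ` of trigonometric
polynomials. -/
def AlmostPeriodic (f : ℝ → ℂ) : Prop :=
  ∃ g : ℕ → ℝ → ℂ, (∀ n, IsTrigPoly (g n)) ∧ TendstoUniformly g f atTop

/-- A trigonometric polynomial is recurrent along integer translations. -/
theorem IsTrigPoly.mapClusterPt_add_natCast {g : ℝ → ℂ} (hg : IsTrigPoly g) (x : ℝ) :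
    MapClusterPt (g x) atTop (fun n : ℕ => g (x + n)) := by
  obtain ⟨m, c, μ, hg⟩ := hg
  let F : (Fin m → Circle) → ℂ := fun w =>
    ∑ i, c i * Complex.exp (Complex.I * (μ i : ℂ) * (x : ℂ)) * (w i : ℂ)
  have hF : Continuous F := by fun_prop
  have hcluster := (mapClusterPt_one_atTop_pow (fun i => Circle.exp (μ i))).continuousAt_comp
    hF.continuousAt
  have hone : F 1 = g x := by simp [F, hg]
  have hpow : (F ∘ fun n : ℕ => (fun i => Circle.exp (μ i)) ^ n) = fun n : ℕ => g (x + n) := by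
    funext n
    simp only [F, Function.comp_apply, hg, Pi.pow_apply, Circle.coe_pow, Circle.coe_exp,
      ← Complex.exp_nat_mul, mul_assoc, ← Complex.exp_add]
    refine Finset.sum_congr rfl fun i _ => ?_
    push_cast
    ring_nf
  rwa [hone, hpow] at hcluster

/-- An almost periodic function which vanishes at infinity is identically zero. -/
theorem almostPeriodic_vanishing_at_infty_eq_zero (f : ℝ → ℂ)
    (hap : AlmostPeriodic f) (hvan : Tendsto f (cocompact ℝ) (nhds 0)) :
    ∀ x, f x = 0 := by
  obtain ⟨g, hg, hgf⟩ := hap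
  intro x
  have hshift : Tendsto (fun n : ℕ => f (x + n)) atTop (nhds 0) :=
    (hvan.mono_left atTop_le_cocompact).comp
      (tendsto_atTop_add_const_left _ x tendsto_natCast_atTop_atTop)
  refine dist_le_zero.mp (le_of_forall_pos_le_add fun ε hε => ?_)
  have hε4 : 0 < ε / 4 := by positivity
  obtain ⟨N, hN⟩ := (Metric.tendstoUniformly_iff.mp hgf (ε / 4) hε4).exists
  obtain ⟨n, hrec, hsmall⟩ :=
    (((hg N).mapClusterPt_add_natCast x).frequently (Metric.ball_mem_nhds _ hε4)).and_eventually
      (hshift.eventually (Metric.ball_mem_nhds _ hε4)) |>.exists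
  have hx := hN x
  have hxn := hN (x + n)
  rw [dist_comm] at hrec hxn
  linarith [dist_triangle4 (f x) (g N x) (g N (x + n)) (f (x + n)),
    dist_triangle (f x) (f (x + n)) 0]
end

section
/- For every piecewise analytic graph γ = (e₁, …, eₙ) in ℝ³ there exist a piecewise linear graph α = (f₁, …, fₙ) in ℝ³ and a homeomorphism ξ : ℝ³ → ℝ³ such that for each i, ξ maps the image of eᵢ onto the image of fᵢ with ξ(eᵢ(0)) = fᵢ(0) and ξ(eᵢ(1)) = fᵢ(1). In other words, every knot class of a piecewise analytic graph contains a piecewise linear graph. -/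
open Set

/-- `e` agrees with an affine map on the interval `[a, b]`. -/
def AffineOnIcc (e : ℝ → E3) (a b : ℝ) : Prop :=
  ∃ A : ℝ →ᵃ[ℝ] E3, ∀ t ∈ Set.Icc a b, e t = A t

/-- A piecewise linear edge: a continuous injective map on `[0,1]` which is affine on each
subinterval of some partition `0 = t₀ < t₁ < ⋯ < t_k = 1`. -/
def IsPLEdge (e : ℝ → E3) : Prop :=
  ContinuousOn e (Set.Icc 0 1) ∧ Set.InjOn e (Set.Icc 0 1) ∧
  ∃ (k : ℕ) (t : Fin (k + 1) → ℝ), StrictMono t ∧ t 0 = 0 ∧ t (Fin.last k) = 1 ∧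
    ∀ j : Fin k, AffineOnIcc e (t j.castSucc) (t j.succ)

/-- A piecewise analytic edge: a continuous injective map on `[0,1]` which, on each subinterval
of some partition `0 = t₀ < t₁ < ⋯ < t_k = 1`, agrees with the restriction of a map that is
real-analytic on an open interval containing the subinterval. -/
def IsPAEdge (e : ℝ → E3) : Prop :=
  ContinuousOn e (Set.Icc 0 1) ∧ Set.InjOn e (Set.Icc 0 1) ∧
  ∃ (k : ℕ) (t : Fin (k + 1) → ℝ), StrictMono t ∧ t 0 = 0 ∧ t (Fin.last k) = 1 ∧
    ∀ j : Fin k, ∃ (u v : ℝ) (g : ℝ → E3), u < t j.castSucc ∧ t j.succ < v ∧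
      AnalyticOnNhd ℝ g (Set.Ioo u v) ∧
      Set.EqOn e g (Set.Icc (t j.castSucc) (t j.succ))

/-- The piecewise linear bump function of height one supported on `[l, u]` with peak at `p`. -/
noncomputable def tent (l p u y : ℝ) : ℝ :=
  max 0 (min 1 (min ((y - l) / (p - l)) ((u - y) / (u - p))))

lemma tent_nonneg (l p u y : ℝ) : 0 ≤ tent l p u y := le_max_left _ _

lemma tent_le_one (l p u y : ℝ) : tent l p u y ≤ 1 :=
  max_le zero_le_one (min_le_left _ _)

lemma tent_of_le_left {l p u y : ℝ} (hlp : l < p) (hy : y ≤ l) : tent l p u y = 0 := by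
  have h : (y - l) / (p - l) ≤ 0 := div_nonpos_of_nonpos_of_nonneg (by linarith) (by linarith)
  exact max_eq_left ((min_le_right _ _).trans ((min_le_left _ _).trans h))

lemma tent_of_right_le {l p u y : ℝ} (hpu : p < u) (hy : u ≤ y) : tent l p u y = 0 := by
  have h : (u - y) / (u - p) ≤ 0 := div_nonpos_of_nonpos_of_nonneg (by linarith) (by linarith)
  exact max_eq_left ((min_le_right _ _).trans ((min_le_right _ _).trans h))

lemma tent_of_mem_left {l p u y : ℝ} (hlp : l < p) (hpu : p < u) (hy : l ≤ y) (hy' : y ≤ p) :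
    tent l p u y = (y - l) / (p - l) := by
  have h0 : 0 ≤ (y - l) / (p - l) := div_nonneg (by linarith) (by linarith)
  have h1 : (y - l) / (p - l) ≤ 1 := (div_le_one (by linarith)).2 (by linarith)
  have h2 : 1 ≤ (u - y) / (u - p) := (one_le_div (by linarith)).2 (by linarith)
  rw [tent, min_eq_left (h1.trans h2), min_eq_right h1, max_eq_right h0]

lemma tent_of_mem_right {l p u y : ℝ} (hlp : l < p) (hpu : p < u) (hy : p ≤ y) (hy' : y ≤ u) :
    tent l p u y = (u - y) / (u - p) := by
  have h0 : 0 ≤ (u - y) / (u - p) := div_nonneg (by linarith) (by linarith)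
  have h1 : (u - y) / (u - p) ≤ 1 := (div_le_one (by linarith)).2 (by linarith)
  have h2 : 1 ≤ (y - l) / (p - l) := (one_le_div (by linarith)).2 (by linarith)
  rw [tent, min_eq_right (h1.trans h2), min_eq_right h1, max_eq_right h0]

lemma tent_peak {l p u : ℝ} (hlp : l < p) (hpu : p < u) : tent l p u p = 1 := by
  rw [tent_of_mem_left hlp hpu hlp.le le_rfl, div_self (by linarith)]

/-- The piecewise linear map moving `p` to `q` carries the bump at `p` to the bump at `q`. -/
lemma tent_push {l p q u : ℝ} (hlp : l < p) (hpu : p < u) (hlq : l < q) (hqu : q < u) (y : ℝ) :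
    tent l q u (y + (q - p) * tent l p u y) = tent l p u y := by
  have hp : p - l ≠ 0 := by linarith
  have hu : u - p ≠ 0 := by linarith
  have hq : q - l ≠ 0 := by linarith
  have hqu' : u - q ≠ 0 := by linarith
  rcases le_total y l with h | h
  · rw [tent_of_le_left hlp h, mul_zero, add_zero, tent_of_le_left hlq h]
  rcases le_total u y with h' | h'
  · rw [tent_of_right_le hpu h', mul_zero, add_zero, tent_of_right_le hqu h']
  rcases le_total y p with h'' | h''
  · rw [tent_of_mem_left hlp hpu h h'']
    have e : y + (q - p) * ((y - l) / (p - l)) = l + (q - l) * ((y - l) / (p - l)) := by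
      field_simp; ring
    have h0 : 0 ≤ (y - l) / (p - l) := div_nonneg (by linarith) (by linarith)
    have h1 : (y - l) / (p - l) ≤ 1 := (div_le_one (by linarith)).2 (by linarith)
    rw [e, tent_of_mem_left hlq hqu (by nlinarith) (by nlinarith)]
    field_simp; ring
  · rw [tent_of_mem_right hlp hpu h'' h']
    have e : y + (q - p) * ((u - y) / (u - p)) = u - (u - q) * ((u - y) / (u - p)) := by
      field_simp; ring
    have h0 : 0 ≤ (u - y) / (u - p) := div_nonneg (by linarith) (by linarith)
    have h1 : (u - y) / (u - p) ≤ 1 := (div_le_one (by linarith)).2 (by linarith)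
    rw [e, tent_of_mem_right hlq hqu (by nlinarith) (by nlinarith)]
    field_simp; ring

lemma tent_sub_le {l p u y y' : ℝ} (hlp : l < p) (hpu : p < u) (h : y ≤ y') :
    tent l p u y' - tent l p u y ≤ (y' - y) / (p - l) := by
  have h0 : 0 ≤ (y' - y) / (p - l) := div_nonneg (by linarith) (by linarith)
  have hA : (y' - l) / (p - l) = (y - l) / (p - l) + (y' - y) / (p - l) := by
    rw [← add_div]; ring_nf
  have hB : (u - y') / (u - p) ≤ (u - y) / (u - p) :=
    div_le_div_of_nonneg_right (by linarith) (by linarith)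
  unfold tent
  grind

lemma sub_tent_le {l p u y y' : ℝ} (hlp : l < p) (hpu : p < u) (h : y ≤ y') :
    tent l p u y - tent l p u y' ≤ (y' - y) / (u - p) := by
  have h0 : 0 ≤ (y' - y) / (u - p) := div_nonneg (by linarith) (by linarith)
  have hB : (u - y) / (u - p) = (u - y') / (u - p) + (y' - y) / (u - p) := by
    rw [← add_div]; ring_nf
  have hA : (y - l) / (p - l) ≤ (y' - l) / (p - l) :=
    div_le_div_of_nonneg_right (by linarith) (by linarith)
  unfold tent
  grind

lemma push_strictMono {l p q u : ℝ} (hlp : l < p) (hpu : p < u) (hlq : l < q) (hqu : q < u) :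
    StrictMono fun y => y + (q - p) * tent l p u y := by
  intro y y' h
  have h1 := tent_sub_le hlp hpu h.le
  have h2 := sub_tent_le hlp hpu h.le
  rw [le_div_iff₀ (by linarith)] at h1 h2
  rcases le_total p q with hpq | hpq
  · by_contra! hc
    have : 0 < tent l p u y - tent l p u y' := by nlinarith
    nlinarith
  · by_contra! hc
    have : 0 < tent l p u y' - tent l p u y := by nlinarith
    nlinarith

lemma continuous_mul_tent {a b : ℝ} {d l p u : ℝ → ℝ} (hd : Continuous d) (hl : Continuous l)
    (hp : Continuous p) (hu : Continuous u) (hd0 : ∀ x ∉ Ioo a b, d x = 0)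
    (hlp : ∀ x ∈ Ioo a b, l x < p x) (hpu : ∀ x ∈ Ioo a b, p x < u x) :
    Continuous fun v : ℝ × ℝ => d v.1 * tent (l v.1) (p v.1) (u v.1) v.2 := by
  rw [continuous_iff_continuousAt]
  rintro ⟨x, y⟩
  by_cases hx : x ∈ Ioo a b
  · have h1 : p x - l x ≠ 0 := by linarith [hlp x hx]
    have h2 : u x - p x ≠ 0 := by linarith [hpu x hx]
    unfold tent
    fun_prop (disch := assumption)
  · have hz : d x = 0 := hd0 x hx
    have h0 : Filter.Tendsto (fun v : ℝ × ℝ => |d v.1|) (nhds (x, y)) (nhds 0) := by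
      have : Continuous fun v : ℝ × ℝ => |d v.1| := by fun_prop
      simpa [hz] using this.tendsto (x, y)
    rw [ContinuousAt]
    simp only [hz, zero_mul]
    refine squeeze_zero_norm (fun v => ?_) h0
    rw [Real.norm_eq_abs, abs_mul, abs_of_nonneg (tent_nonneg _ _ _ _)]
    exact mul_le_of_le_one_right (abs_nonneg _) (tent_le_one _ _ _ _)

/-- A homeomorphism of space, supported in the slab `a < x < b` and between the graphs of
`l` and `u`, that pushes the graph of `p` to the graph of `q` and lifts it by `d`. -/
lemma exists_push {a b : ℝ} {l u p q d : ℝ → ℝ} (hl : Continuous l) (hu : Continuous u)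
    (hp : Continuous p) (hq : Continuous q) (hd : Continuous d)
    (hlp : ∀ x ∈ Ioo a b, l x < p x) (hpu : ∀ x ∈ Ioo a b, p x < u x)
    (hlq : ∀ x ∈ Ioo a b, l x < q x) (hqu : ∀ x ∈ Ioo a b, q x < u x)
    (hpq : ∀ x ∉ Ioo a b, p x = q x) (hd0 : ∀ x ∉ Ioo a b, d x = 0) :
    ∃ Θ : (ℝ × ℝ × ℝ) ≃ₜ (ℝ × ℝ × ℝ), (∀ v, (Θ v).1 = v.1) ∧
      (∀ v w, v.1 = w.1 → v.2.1 < w.2.1 → (Θ v).2.1 < (Θ w).2.1) ∧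
      (∀ v, v.1 ∉ Ioo a b → Θ v = v) ∧
      (∀ v, v.1 ∈ Ioo a b → v.2.1 ≤ l v.1 ∨ u v.1 ≤ v.2.1 → Θ v = v) ∧
      ∀ x ∈ Ioo a b, ∀ z, Θ (x, p x, z) = (x, q x, z + d x) := by
  let T : (ℝ → ℝ) → (ℝ → ℝ) → (ℝ → ℝ) → ℝ × ℝ × ℝ → ℝ × ℝ × ℝ := fun p q d v =>
    (v.1, v.2.1 + (q v.1 - p v.1) * tent (l v.1) (p v.1) (u v.1) v.2.1,
      v.2.2 + d v.1 * tent (l v.1) (p v.1) (u v.1) v.2.1)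
  have hT : ∀ p q d : ℝ → ℝ, Continuous p → Continuous q → Continuous d →
      (∀ x ∈ Ioo a b, l x < p x) → (∀ x ∈ Ioo a b, p x < u x) →
      (∀ x ∉ Ioo a b, p x = q x) → (∀ x ∉ Ioo a b, d x = 0) → Continuous (T p q d) := by
    intro p q d hp hq hd hlp hpu hpq hd0
    have h1 : Continuous fun v : ℝ × ℝ => (q v.1 - p v.1) * tent (l v.1) (p v.1) (u v.1) v.2 :=
      continuous_mul_tent (hq.sub hp) hl hp hu (fun x hx => by simp [hpq x hx]) hlp hpu
    have h2 := continuous_mul_tent hd hl hp hu hd0 hlp hpu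
    have h3 : Continuous fun v : ℝ × ℝ × ℝ => (v.1, v.2.1) := by fun_prop
    have h1' := h1.comp h3
    have h2' := h2.comp h3
    simp only [Function.comp_def] at h1' h2'
    exact continuous_fst.prodMk (((continuous_fst.comp continuous_snd).add h1').prodMk
      ((continuous_snd.comp continuous_snd).add h2'))
  have hinv : ∀ p q d : ℝ → ℝ, (∀ x ∈ Ioo a b, l x < p x) → (∀ x ∈ Ioo a b, p x < u x) →
      (∀ x ∈ Ioo a b, l x < q x) → (∀ x ∈ Ioo a b, q x < u x) →
      (∀ x ∉ Ioo a b, p x = q x) → (∀ x ∉ Ioo a b, d x = 0) →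
      ∀ v, T q p (-d) (T p q d v) = v := by
    rintro p q d hlp hpu hlq hqu hpq hd0 ⟨x, y, z⟩
    by_cases hx : x ∈ Ioo a b
    · simp only [T, tent_push (hlp x hx) (hpu x hx) (hlq x hx) (hqu x hx), Pi.neg_apply]
      ext <;> simp
      ring
    · simp [T, hpq x hx, hd0 x hx]
  refine ⟨⟨⟨T p q d, T q p (-d), hinv p q d hlp hpu hlq hqu hpq hd0, ?_⟩,
    hT p q d hp hq hd hlp hpu hpq hd0, ?_⟩, fun v => rfl, ?_, ?_, ?_, ?_⟩
  · have := hinv q p (-d) hlq hqu hlp hpu (fun x hx => (hpq x hx).symm)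
      (fun x hx => by simp [hd0 x hx])
    rw [neg_neg] at this
    exact this
  · exact hT q p (-d) hq hp hd.neg hlq hqu (fun x hx => (hpq x hx).symm)
      (fun x hx => by simp [hd0 x hx])
  · rintro ⟨x, y, z⟩ ⟨x', y', z'⟩ h h'
    obtain rfl : x = x' := h
    change y + _ < y' + _
    by_cases hx : x ∈ Ioo a b
    · exact push_strictMono (hlp x hx) (hpu x hx) (hlq x hx) (hqu x hx) h'
    · simpa [hpq x hx] using h'
  · rintro ⟨x, y, z⟩ hx
    change T p q d _ = _
    have hx : x ∉ Ioo a b := hx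
    simp [T, hpq x hx, hd0 x hx]
  · rintro ⟨x, y, z⟩ hx hy
    have h0 : tent (l x) (p x) (u x) y = 0 :=
      hy.elim (tent_of_le_left (hlp x hx)) (tent_of_right_le (hpu x hx))
    change T p q d _ = _
    simp [T, h0]
  · intro x hx z
    change T p q d _ = _
    simp [T, tent_peak (hlp x hx) (hpu x hx)]

lemma exists_continuous_between_left {κ : Type*} {a b : ℝ} (A : Finset κ) {f : κ → ℝ → ℝ}
    {m : ℝ → ℝ} (hf : ∀ k, Continuous (f k)) (hm : Continuous m)
    (h : ∀ k ∈ A, ∀ x ∈ Ioo a b, f k x < m x) :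
    ∃ l : ℝ → ℝ, Continuous l ∧ (∀ x ∈ Ioo a b, l x < m x) ∧
      ∀ k ∈ A, ∀ x ∈ Ioo a b, f k x ≤ l x := by
  classical
  induction A using Finset.induction_on with
  | empty => exact ⟨fun x => m x - 1, by fun_prop, fun x _ => by linarith, by simp⟩
  | insert r s _ ih =>
    obtain ⟨l, hl, hlm, hfl⟩ := ih fun k hk => h k (Finset.mem_insert_of_mem hk)
    refine ⟨fun x => max (l x) (f r x), hl.max (hf r), fun x hx =>
      max_lt (hlm x hx) (h r (Finset.mem_insert_self _ _) x hx), fun k hk x hx => ?_⟩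
    rcases Finset.mem_insert.1 hk with rfl | hk
    · exact le_max_right _ _
    · exact (hfl k hk x hx).trans (le_max_left _ _)

lemma exists_continuous_between_right {κ : Type*} {a b : ℝ} (A : Finset κ) {f : κ → ℝ → ℝ}
    {m : ℝ → ℝ} (hf : ∀ k, Continuous (f k)) (hm : Continuous m)
    (h : ∀ k ∈ A, ∀ x ∈ Ioo a b, m x < f k x) :
    ∃ u : ℝ → ℝ, Continuous u ∧ (∀ x ∈ Ioo a b, m x < u x) ∧
      ∀ k ∈ A, ∀ x ∈ Ioo a b, u x ≤ f k x := by
  obtain ⟨l, hl, hlm, hfl⟩ := exists_continuous_between_left (a := a) (b := b) A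
    (f := fun k x => -f k x) (m := fun x => -m x) (fun k => (hf k).neg) hm.neg
    fun k hk x hx => neg_lt_neg (h k hk x hx)
  exact ⟨fun x => -l x, hl.neg, fun x hx => by linarith [hlm x hx],
    fun k hk x hx => by linarith [hfl k hk x hx]⟩

/-- The relative position required of two strands over the slabs `(a, b)` and `(a', b')`: the
slabs are disjoint, or they agree and the strands coincide, or their `y`-coordinates are ordered
in the same way before and after straightening. -/
def StrandsCompatible {κ : Type*} (a b : κ → ℝ) (Y Z Y' Z' : κ → ℝ → ℝ) (k j : κ) : Prop :=
  Disjoint (Ioo (a k) (b k)) (Ioo (a j) (b j)) ∨ (a k = a j ∧ b k = b j ∧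
    ((∀ x ∈ Ioo (a k) (b k), Y k x = Y j x ∧ Z k x = Z j x ∧ Y' k x = Y' j x ∧ Z' k x = Z' j x) ∨
    (∀ x ∈ Ioo (a k) (b k), Y k x < Y j x ∧ Y' k x < Y' j x) ∨
    (∀ x ∈ Ioo (a k) (b k), Y j x < Y k x ∧ Y' j x < Y' k x)))

lemma left_notMem_of_disjoint_Ioo {a b c d : ℝ} (hab : a < b)
    (h : Disjoint (Ioo a b) (Ioo c d)) : a ∉ Ioo c d := by
  intro ha
  obtain ⟨m, hm, hm'⟩ := exists_between (lt_min hab ha.2)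
  exact Set.disjoint_left.1 h ⟨hm, hm'.trans_le (min_le_left _ _)⟩
    ⟨ha.1.trans hm, hm'.trans_le (min_le_right _ _)⟩

lemma right_notMem_of_disjoint_Ioo {a b c d : ℝ} (hab : a < b)
    (h : Disjoint (Ioo a b) (Ioo c d)) : b ∉ Ioo c d := by
  intro hb
  obtain ⟨m, hm, hm'⟩ := exists_between (max_lt hab hb.1)
  exact Set.disjoint_left.1 h ⟨(le_max_left _ _).trans_lt hm, hm'⟩
    ⟨(le_max_right _ _).trans_lt hm, hm'.trans hb.2⟩

/-- Finitely many pairwise compatible strands can be moved simultaneously by a level-preserving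
homeomorphism that is the identity off the open slabs. -/
lemma exists_homeomorph_move_strands {κ : Type*} [Finite κ] {a b : κ → ℝ}
    {Y Z Y' Z' : κ → ℝ → ℝ} (hab : ∀ k, a k < b k)
    (hY : ∀ k, Continuous (Y k)) (hZ : ∀ k, Continuous (Z k))
    (hY' : ∀ k, Continuous (Y' k)) (hZ' : ∀ k, Continuous (Z' k))
    (hYa : ∀ k, Y' k (a k) = Y k (a k)) (hYb : ∀ k, Y' k (b k) = Y k (b k))
    (hZa : ∀ k, Z' k (a k) = Z k (a k)) (hZb : ∀ k, Z' k (b k) = Z k (b k))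
    (hcomp : ∀ k j, StrandsCompatible a b Y Z Y' Z' k j) :
    ∃ Φ : (ℝ × ℝ × ℝ) ≃ₜ (ℝ × ℝ × ℝ), (∀ v, (∀ k, v.1 ∉ Ioo (a k) (b k)) → Φ v = v) ∧
      ∀ k, ∀ x ∈ Ioo (a k) (b k), Φ (x, Y k x, Z k x) = (x, Y' k x, Z' k x) := by
  classical
  have := Fintype.ofFinite κ
  have ha : ∀ r k, a r ∉ Ioo (a k) (b k) := by
    intro r k
    rcases hcomp r k with h | ⟨h, -⟩
    · exact left_notMem_of_disjoint_Ioo (hab r) h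
    · simp [h]
  have hb : ∀ r k, b r ∉ Ioo (a k) (b k) := by
    intro r k
    rcases hcomp r k with h | ⟨-, h, -⟩
    · exact right_notMem_of_disjoint_Ioo (hab r) h
    · simp [h]
  suffices H : ∀ s : Finset κ, ∃ Φ : (ℝ × ℝ × ℝ) ≃ₜ (ℝ × ℝ × ℝ), (∀ v, (Φ v).1 = v.1) ∧
      (∀ v w, v.1 = w.1 → v.2.1 < w.2.1 → (Φ v).2.1 < (Φ w).2.1) ∧
      (∀ v, (∀ k, v.1 ∉ Ioo (a k) (b k)) → Φ v = v) ∧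
      ∀ k ∈ s, ∀ x ∈ Ioo (a k) (b k), Φ (x, Y k x, Z k x) = (x, Y' k x, Z' k x) by
    obtain ⟨Φ, -, -, h1, h2⟩ := H Finset.univ
    exact ⟨Φ, h1, fun k => h2 k (Finset.mem_univ k)⟩
  intro s
  induction s using Finset.induction_on with
  | empty => exact ⟨Homeomorph.refl _, by simp, by simp, by simp, by simp⟩
  | insert r s hr ih =>
    obtain ⟨Φ, hfst, hmono, hfix, hmove⟩ := ih
    by_cases hex : ∃ j ∈ s, a r = a j ∧ b r = b j ∧ ∀ x ∈ Ioo (a r) (b r), Y r x = Y j x ∧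
        Z r x = Z j x ∧ Y' r x = Y' j x ∧ Z' r x = Z' j x
    · obtain ⟨j, hj, haj, hbj, heq⟩ := hex
      refine ⟨Φ, hfst, hmono, hfix, fun k hk x hx => ?_⟩
      rcases Finset.mem_insert.1 hk with rfl | hk
      · obtain ⟨e1, e2, e3, e4⟩ := heq x hx
        rw [e1, e2, e3, e4]
        exact hmove j hj x (by rwa [← haj, ← hbj])
      · exact hmove k hk x hx
    push Not at hex
    let c : ℝ → ℝ := fun x => max (a r) (min (b r) x)
    have hc : Continuous c := by fun_prop
    have hcx : ∀ x ∈ Ioo (a r) (b r), c x = x := fun x hx => by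
      simp only [c, min_eq_right hx.2.le, max_eq_right hx.1.le]
    have hcx' : ∀ x ∉ Ioo (a r) (b r), c x = a r ∨ c x = b r := by
      intro x hx
      rcases le_or_gt x (a r) with h | h
      · exact Or.inl (max_eq_left ((min_le_right _ _).trans h))
      · have h' : b r ≤ x := not_lt.1 fun h' => hx ⟨h, h'⟩
        right
        simp only [c, min_eq_left h', max_eq_right (hab r).le]
    let w : ℝ → ℝ × ℝ × ℝ := fun x => Φ (c x, Y r (c x), Z r (c x))
    have hw : Continuous w := Φ.continuous.comp
      (hc.prodMk (((hY r).comp hc).prodMk ((hZ r).comp hc)))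
    have hw' : ∀ x ∉ Ioo (a r) (b r), (w x).2.1 = Y' r (c x) ∧ (w x).2.2 = Z' r (c x) := by
      intro x hx
      rcases hcx' x hx with h | h
      · simp only [w, h]
        rw [hfix _ (ha r), hYa, hZa]
        exact ⟨rfl, rfl⟩
      · simp only [w, h]
        rw [hfix _ (hb r), hYb, hZb]
        exact ⟨rfl, rfl⟩
    let p : ℝ → ℝ := fun x => (w x).2.1
    let q : ℝ → ℝ := fun x => Y' r (c x)
    let d : ℝ → ℝ := fun x => Z' r (c x) - (w x).2.2
    have hp : Continuous p := by fun_prop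
    have hq : Continuous q := (hY' r).comp hc
    have hd : Continuous d := ((hZ' r).comp hc).sub (by fun_prop)
    have hlow : ∀ j ∈ s, (a r = a j ∧ b r = b j ∧
        ∀ x ∈ Ioo (a r) (b r), Y j x < Y r x ∧ Y' j x < Y' r x) →
        ∀ x ∈ Ioo (a r) (b r), Y' j x < min (p x) (q x) := by
      rintro j hj ⟨haj, hbj, h⟩ x hx
      refine lt_min ?_ ?_
      · have h1 := hmono (x, Y j x, Z j x) (x, Y r x, Z r x) rfl (h x hx).1
        rw [hmove j hj x (by rwa [← haj, ← hbj])] at h1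
        simpa only [p, w, hcx x hx] using h1
      · simpa only [q, hcx x hx] using (h x hx).2
    have hupp : ∀ j ∈ s, (a r = a j ∧ b r = b j ∧
        ∀ x ∈ Ioo (a r) (b r), Y r x < Y j x ∧ Y' r x < Y' j x) →
        ∀ x ∈ Ioo (a r) (b r), max (p x) (q x) < Y' j x := by
      rintro j hj ⟨haj, hbj, h⟩ x hx
      refine max_lt ?_ ?_
      · have h1 := hmono (x, Y r x, Z r x) (x, Y j x, Z j x) rfl (h x hx).1
        rw [hmove j hj x (by rwa [← haj, ← hbj])] at h1
        simpa only [p, w, hcx x hx] using h1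
      · simpa only [q, hcx x hx] using (h x hx).2
    obtain ⟨l, hl, hlm, hfl⟩ := exists_continuous_between_left
      (s.filter fun j => a r = a j ∧ b r = b j ∧
        ∀ x ∈ Ioo (a r) (b r), Y j x < Y r x ∧ Y' j x < Y' r x)
      hY' (hp.min hq) fun j hj => hlow j (Finset.mem_filter.1 hj).1 (Finset.mem_filter.1 hj).2
    obtain ⟨u, hu, hum, hfu⟩ := exists_continuous_between_right
      (s.filter fun j => a r = a j ∧ b r = b j ∧
        ∀ x ∈ Ioo (a r) (b r), Y r x < Y j x ∧ Y' r x < Y' j x)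
      hY' (hp.max hq) fun j hj => hupp j (Finset.mem_filter.1 hj).1 (Finset.mem_filter.1 hj).2
    obtain ⟨Θ, tfst, tmono, tfix, tfix', tmove⟩ := exists_push hl hu hp hq hd
      (fun x hx => (hlm x hx).trans_le (min_le_left _ _))
      (fun x hx => (le_max_left _ _).trans_lt (hum x hx))
      (fun x hx => (hlm x hx).trans_le (min_le_right _ _))
      (fun x hx => (le_max_right _ _).trans_lt (hum x hx))
      (fun x hx => (hw' x hx).1) (fun x hx => sub_eq_zero.2 (hw' x hx).2.symm)
    refine ⟨Φ.trans Θ, fun v => by simp [tfst, hfst], fun v v' h h' => ?_, fun v hv => ?_,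
      fun k hk x hx => ?_⟩
    · exact tmono (Φ v) (Φ v') (by rw [hfst, hfst, h]) (hmono _ _ h h')
    · rw [Homeomorph.trans_apply, hfix v hv, tfix v (hv r)]
    · rw [Homeomorph.trans_apply]
      rcases Finset.mem_insert.1 hk with rfl | hk
      · have h1 : Φ (x, Y k x, Z k x) = (x, p x, (w x).2.2) := by
          have h2 := hfst (x, Y k x, Z k x)
          simp only [p, w, hcx x hx]
          ext <;> simp [h2]
        rw [h1, tmove x hx]
        simp [q, d, hcx x hx]
      · rw [hmove k hk x hx]
        rcases hcomp r k with h | ⟨h1, h2, h3⟩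
        · exact tfix _ (Set.disjoint_right.1 h hx)
        · have hx' : x ∈ Ioo (a r) (b r) := by rwa [h1, h2]
          rcases h3 with h3 | h3 | h3
          · obtain ⟨x', hx', hne⟩ := hex k hk h1 h2
            obtain ⟨e1, e2, e3, e4⟩ := h3 x' hx'
            exact absurd e4 (hne e1 e2 e3)
          · exact tfix' _ hx' (Or.inr (hfu k (Finset.mem_filter.2 ⟨hk, h1, h2, h3⟩) x hx'))
          · exact tfix' _ hx' (Or.inl (hfl k (Finset.mem_filter.2 ⟨hk, h1, h2, h3⟩) x hx'))

lemma exists_continuous_comp_eq {f y : ℝ → ℝ} {s t : ℝ} (hf : ContinuousOn f (Icc s t))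
    (hinj : InjOn f (Icc s t)) (hy : ContinuousOn y (Icc s t)) :
    ∃ Y : ℝ → ℝ, Continuous Y ∧ ∀ u ∈ Icc s t, Y (f u) = y u := by
  have he : Topology.IsClosedEmbedding ((Icc s t).domRestrict f) :=
    hf.domRestrict.isClosedEmbedding (injOn_iff_injective.1 hinj)
  obtain ⟨g, hg⟩ := ContinuousMap.exists_extension he ⟨(Icc s t).domRestrict y, hy.domRestrict⟩
  exact ⟨g, g.continuous, fun u hu => DFunLike.congr_fun hg ⟨u, hu⟩⟩

lemma IsPreconnected.forall_lt_or_forall_gt {S : Set ℝ} (hS : IsPreconnected S) {f g : ℝ → ℝ}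
    (hf : Continuous f) (hg : Continuous g) (h : ∀ v ∈ S, f v ≠ g v) :
    (∀ v ∈ S, f v < g v) ∨ ∀ v ∈ S, g v < f v := by
  by_contra! hc
  obtain ⟨⟨v, hv, hv'⟩, w, hw, hw'⟩ := hc
  obtain ⟨m, -, hm⟩ := hS _ _ (isOpen_lt hf hg) (isOpen_lt hg hf)
    (fun u hu => (h u hu).lt_or_gt) ⟨w, hw, lt_of_le_of_ne hw' (h w hw)⟩
    ⟨v, hv, lt_of_le_of_ne hv' (h v hv).symm⟩
  exact lt_asymm (show f m < g m from hm.1) hm.2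

/-- Affine interpolation of the values of `Y` at `a` and `b`. -/
noncomputable def chord (Y : ℝ → ℝ) (a b v : ℝ) : ℝ := Y a + (Y b - Y a) * ((v - a) / (b - a))

lemma continuous_chord (Y : ℝ → ℝ) (a b : ℝ) : Continuous (chord Y a b) := by
  unfold chord
  fun_prop

lemma chord_left (Y : ℝ → ℝ) (a b : ℝ) : chord Y a b a = Y a := by simp [chord]

lemma chord_right (Y : ℝ → ℝ) {a b : ℝ} (h : a < b) : chord Y a b b = Y b := by
  rw [chord, div_self (by linarith)]; ring

lemma chord_lt_chord {Y W : ℝ → ℝ} {a b v : ℝ} (hv : v ∈ Ioo a b) (ha : Y a ≤ W a)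
    (hb : Y b ≤ W b) (h : Y a < W a ∨ Y b < W b) : chord Y a b v < chord W a b v := by
  have hab : 0 < b - a := by linarith [hv.1, hv.2]
  have h0 : 0 < (v - a) / (b - a) := div_pos (by linarith [hv.1]) hab
  have h1 : (v - a) / (b - a) < 1 := (div_lt_one hab).2 (by linarith [hv.2])
  unfold chord
  rcases h with h | h <;> nlinarith

lemma image_chord_eq_segment (Y Z : ℝ → ℝ) {a b : ℝ} (h : a < b) :
    (fun v => (v, chord Y a b v, chord Z a b v)) '' Icc a b =
      segment ℝ (a, Y a, Z a) (b, Y b, Z b) := by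
  have hab : 0 < b - a := by linarith
  rw [segment_eq_image_lineMap]
  ext p
  constructor
  · rintro ⟨v, hv, rfl⟩
    refine ⟨(v - a) / (b - a), ⟨div_nonneg (by linarith [hv.1]) hab.le,
      (div_le_one hab).2 (by linarith [hv.2])⟩, ?_⟩
    simp only [AffineMap.lineMap_apply, chord]
    ext
    · simp; field_simp; ring
    · simp; ring
    · simp; ring
  · rintro ⟨θ, hθ, rfl⟩
    refine ⟨a + θ * (b - a), ⟨by nlinarith [hθ.1], by nlinarith [hθ.2]⟩, ?_⟩
    have : (a + θ * (b - a) - a) / (b - a) = θ := by field_simp; ring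
    simp only [AffineMap.lineMap_apply, chord, this]
    ext <;> simp <;> ring

lemma Ioo_disjoint_or_eq {L : Set ℝ} {a b c d : ℝ} (ha : a ∈ L) (hb : b ∈ L) (hc : c ∈ L)
    (hd : d ∈ L) (h : ∀ v ∈ Ioo a b, v ∉ L) (h' : ∀ v ∈ Ioo c d, v ∉ L) :
    Disjoint (Ioo a b) (Ioo c d) ∨ (a = c ∧ b = d) := by
  by_contra! hcon
  obtain ⟨h1, h2⟩ := hcon
  obtain ⟨m, hm, hm'⟩ := Set.not_disjoint_iff.1 h1
  refine h2 (le_antisymm ?_ ?_) (le_antisymm ?_ ?_)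
  · exact not_lt.1 fun hlt => h' a ⟨hlt, hm.1.trans hm'.2⟩ ha
  · exact not_lt.1 fun hlt => h c ⟨hlt, hm'.1.trans hm.2⟩ hc
  · exact not_lt.1 fun hlt => h d ⟨hm.1.trans hm'.2, hlt⟩ hd
  · exact not_lt.1 fun hlt => h' b ⟨hm'.1.trans hm.2, hlt⟩ hb

/-- Two strands over a common slab whose coincidences of `y`-coordinates are open off `L`
either agree or have ordered `y`-coordinates. -/
lemma strand_dichotomy {L : Set ℝ} {a b : ℝ} {Y Z W V : ℝ → ℝ} (hab : a < b) (hY : Continuous Y)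
    (hZ : Continuous Z) (hW : Continuous W) (hV : Continuous V) (hL : ∀ v ∈ Ioo a b, v ∉ L)
    (hend : a ∉ L ∨ b ∉ L)
    (h : ∀ v ∈ Icc a b, v ∉ L → Y v = W v → ∀ᶠ w in nhds v, w ∈ Icc a b → Y w = W w ∧ Z w = V w) :
    (∀ v ∈ Icc a b, Y v = W v ∧ Z v = V v) ∨
    (∀ v ∈ Ioo a b, Y v < W v ∧ chord Y a b v < chord W a b v) ∨
    (∀ v ∈ Ioo a b, W v < Y v ∧ chord W a b v < chord Y a b v) := by
  have hIS : Ioo a b ⊆ Icc a b \ L := fun v hv => ⟨Ioo_subset_Icc_self hv, hL v hv⟩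
  have hcl : closure (Ioo a b) = Icc a b := closure_Ioo hab.ne
  have hS : IsPreconnected (Icc a b \ L) :=
    isPreconnected_Ioo.subset_closure hIS (by rw [hcl]; exact sdiff_subset)
  have haI : a ∈ closure (Ioo a b) := by rw [hcl]; exact left_mem_Icc.2 hab.le
  have hbI : b ∈ closure (Ioo a b) := by rw [hcl]; exact right_mem_Icc.2 hab.le
  by_cases hex : ∃ v ∈ Icc a b \ L, Y v = W v
  · left
    have hall : ∀ v ∈ Icc a b \ L, Y v = W v := by
      by_contra! hne
      obtain ⟨w, hw, hw'⟩ := hne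
      obtain ⟨v, hv, hv'⟩ := hex
      obtain ⟨m, hm, hm1, hm2⟩ := hS {v | ∀ᶠ w in nhds v, w ∈ Icc a b → Y w = W w ∧ Z w = V w}
        {v | Y v ≠ W v} isOpen_setOfPred_eventually_nhds (isOpen_ne_fun hY hW)
        (fun u hu => by
          by_cases he : Y u = W u
          · exact Or.inl (h u hu.1 hu.2 he)
          · exact Or.inr he) ⟨v, hv, h v hv.1 hv.2 hv'⟩ ⟨w, hw, hw'⟩
      exact hm2 (hm1.self_of_nhds hm.1).1
    have h1 : EqOn Y W (Ioo a b) := fun v hv => hall v (hIS hv)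
    have h2 : EqOn Z V (Ioo a b) := fun v hv =>
      ((h v (hIS hv).1 (hIS hv).2 (hall v (hIS hv))).self_of_nhds (hIS hv).1).2
    have h1' := h1.closure hY hW
    have h2' := h2.closure hZ hV
    rw [hcl] at h1' h2'
    exact fun v hv => ⟨h1' hv, h2' hv⟩
  · right
    push Not at hex
    have key : ∀ Y W : ℝ → ℝ, Continuous Y → Continuous W → (∀ v ∈ Icc a b \ L, Y v < W v) →
        ∀ v ∈ Ioo a b, Y v < W v ∧ chord Y a b v < chord W a b v := by
      intro Y W hY hW hlt v hv
      have hle : ∀ v ∈ closure (Ioo a b), Y v ≤ W v := fun v hv =>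
        le_on_closure (fun u hu => (hlt u (hIS hu)).le) hY.continuousOn hW.continuousOn hv
      refine ⟨hlt v (hIS hv), chord_lt_chord hv (hle a haI) (hle b hbI) (hend.imp ?_ ?_)⟩
      · exact fun ha => hlt a ⟨left_mem_Icc.2 hab.le, ha⟩
      · exact fun hb => hlt b ⟨right_mem_Icc.2 hab.le, hb⟩
    exact (hS.forall_lt_or_forall_gt hY hW hex).imp (key Y W hY hW) (key W Y hW hY)

/-- Curves in space whose first coordinates have finite fibres and finitely many local extrema,
and whose projections to the first two coordinates have only finitely many levels with genuine
crossings, are straightened to polygonal curves by a single homeomorphism. -/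
lemma exists_homeomorph_straighten {ι : Type*} [Finite ι] {x y z : ι → ℝ → ℝ}
    (hx : ∀ i, ContinuousOn (x i) (Icc 0 1)) (hy : ∀ i, ContinuousOn (y i) (Icc 0 1))
    (hz : ∀ i, ContinuousOn (z i) (Icc 0 1))
    (hfib : ∀ i c, {t ∈ Icc (0 : ℝ) 1 | x i t = c}.Finite)
    (hextr : ∀ i, {t ∈ Ioo (0 : ℝ) 1 | IsLocalExtr (x i) t}.Finite)
    {F : Set ℝ} (hF : F.Finite)
    (hcross : ∀ i j, ∀ s ∈ Icc (0 : ℝ) 1, ∀ t ∈ Icc (0 : ℝ) 1, x i s = x j t → x i s ∉ F →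
      y i s = y j t → ∀ᶠ q in nhdsWithin (s, t) (Icc (0 : ℝ) 1 ×ˢ Icc (0 : ℝ) 1),
        x i q.1 = x j q.2 → y i q.1 = y j q.2 ∧ z i q.1 = z j q.2) :
    ∃ Φ : (ℝ × ℝ × ℝ) ≃ₜ (ℝ × ℝ × ℝ), ∀ i, ∃ T : Set ℝ, T.Finite ∧ 0 ∈ T ∧ 1 ∈ T ∧
      T ⊆ Icc 0 1 ∧ (∀ τ ∈ T, Φ (x i τ, y i τ, z i τ) = (x i τ, y i τ, z i τ)) ∧
      ∀ τ ∈ T, ∀ τ' ∈ T, τ < τ' → (∀ σ ∈ Ioo τ τ', σ ∉ T) →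
        (fun t => Φ (x i t, y i t, z i t)) '' Icc τ τ' =
          segment ℝ (x i τ, y i τ, z i τ) (x i τ', y i τ', z i τ') := by
  classical
  let L₀ : Set ℝ := F ∪ (range fun i => x i 0) ∪ (range fun i => x i 1) ∪
    ⋃ i, x i '' {t ∈ Ioo (0 : ℝ) 1 | IsLocalExtr (x i) t}
  have hL₀ : L₀.Finite := ((hF.union (finite_range _)).union (finite_range _)).union
    (finite_iUnion fun i => (hextr i).image _)
  let L : Set ℝ := L₀ ∪ image2 (fun u v => (u + v) / 2) L₀ L₀
  have hL : L.Finite := hL₀.union (hL₀.image2 _ hL₀)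
  have hL0L : L₀ ⊆ L := subset_union_left
  let T : ι → Set ℝ := fun i => {t ∈ Icc (0 : ℝ) 1 | x i t ∈ L}
  have hT : ∀ i, (T i).Finite := by
    intro i
    refine (hL.biUnion fun c _ => hfib i c).subset fun t ht => ?_
    exact mem_iUnion₂.2 ⟨x i t, ht.2, ht.1, rfl⟩
  let κ := {k : ι × ℝ × ℝ // k.2.1 ∈ T k.1 ∧ k.2.2 ∈ T k.1 ∧ k.2.1 < k.2.2 ∧
    ∀ σ ∈ Ioo k.2.1 k.2.2, σ ∉ T k.1}
  have hκ : Finite κ := by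
    have h1 : (⋃ i, T i).Finite := finite_iUnion hT
    refine Set.Finite.subset (finite_univ.prod (h1.prod h1)) (fun k hk => ?_)
    exact ⟨mem_univ _, mem_iUnion.2 ⟨_, hk.1⟩, mem_iUnion.2 ⟨_, hk.2.1⟩⟩
  have hsub : ∀ k : κ, Icc k.1.2.1 k.1.2.2 ⊆ Icc 0 1 := fun k =>
    Icc_subset_Icc k.2.1.1.1 k.2.2.1.1.2
  have hinj : ∀ k : κ, InjOn (x k.1.1) (Icc k.1.2.1 k.1.2.2) := by
    intro k
    have key : ∀ s ∈ Icc k.1.2.1 k.1.2.2, ∀ s' ∈ Icc k.1.2.1 k.1.2.2, s < s' →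
        x k.1.1 s ≠ x k.1.1 s' := by
      intro s hs s' hs' hlt heq
      obtain ⟨c, hc, hc'⟩ := exists_isLocalExtr_Ioo hlt
        ((hx k.1.1).mono ((Icc_subset_Icc hs.1 hs'.2).trans (hsub k))) heq
      have hc1 : c ∈ Ioo k.1.2.1 k.1.2.2 := ⟨hs.1.trans_lt hc.1, hc.2.trans_le hs'.2⟩
      have hc0 : c ∈ Ioo (0 : ℝ) 1 := ⟨k.2.1.1.1.trans_lt hc1.1, hc1.2.trans_le k.2.2.1.1.2⟩
      exact k.2.2.2.2 c hc1 ⟨Ioo_subset_Icc_self hc0,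
        hL0L (Or.inr (mem_iUnion.2 ⟨_, c, ⟨hc0, hc'⟩, rfl⟩))⟩
    intro s hs s' hs' heq
    by_contra hne
    rcases lt_or_gt_of_ne hne with h | h
    · exact key s hs s' hs' h heq
    · exact key s' hs' s hs h heq.symm
  have hxk : ∀ k : κ, ContinuousOn (x k.1.1) (Icc k.1.2.1 k.1.2.2) := fun k =>
    (hx k.1.1).mono (hsub k)
  choose Y hY hYx using fun k : κ =>
    exists_continuous_comp_eq (hxk k) (hinj k) ((hy k.1.1).mono (hsub k))
  choose Z hZ hZx using fun k : κ =>
    exists_continuous_comp_eq (hxk k) (hinj k) ((hz k.1.1).mono (hsub k))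
  choose G hG hGx using fun k : κ =>
    exists_continuous_comp_eq (hxk k) (hinj k) continuousOn_id
  let a : κ → ℝ := fun k => min (x k.1.1 k.1.2.1) (x k.1.1 k.1.2.2)
  let b : κ → ℝ := fun k => max (x k.1.1 k.1.2.1) (x k.1.1 k.1.2.2)
  have hl : ∀ k : κ, k.1.2.1 ∈ Icc k.1.2.1 k.1.2.2 := fun k => left_mem_Icc.2 k.2.2.2.1.le
  have hr : ∀ k : κ, k.1.2.2 ∈ Icc k.1.2.1 k.1.2.2 := fun k => right_mem_Icc.2 k.2.2.2.1.le
  have hne : ∀ k : κ, x k.1.1 k.1.2.1 ≠ x k.1.1 k.1.2.2 := fun k h =>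
    k.2.2.2.1.ne (hinj k (hl k) (hr k) h)
  have hab : ∀ k, a k < b k := fun k => min_lt_max.2 (hne k)
  have himg : ∀ k : κ, x k.1.1 '' Icc k.1.2.1 k.1.2.2 = Icc (a k) (b k) := by
    intro k
    refine Subset.antisymm ?_ ?_
    · rintro _ ⟨u, hu, rfl⟩
      rcases (hxk k).strictMonoOn_of_injOn_Icc' k.2.2.2.1.le (hinj k) with h | h
      · exact ⟨(min_le_left _ _).trans (h.monotoneOn (hl k) hu hu.1),
          (h.monotoneOn hu (hr k) hu.2).trans (le_max_right _ _)⟩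
      · exact ⟨(min_le_right _ _).trans (h.antitoneOn hu (hr k) hu.2),
          (h.antitoneOn (hl k) hu hu.1).trans (le_max_left _ _)⟩
    · have h := intermediate_value_uIcc (a := k.1.2.1) (b := k.1.2.2) (f := x k.1.1)
        (by rw [uIcc_of_le k.2.2.2.1.le]; exact hxk k)
      rwa [uIcc_of_le k.2.2.2.1.le] at h
  have haL : ∀ k, a k ∈ L := fun k => by
    rcases min_choice (x k.1.1 k.1.2.1) (x k.1.1 k.1.2.2) with h | h
    · simp only [a, h]; exact k.2.1.2
    · simp only [a, h]; exact k.2.2.1.2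
  have hbL : ∀ k, b k ∈ L := fun k => by
    rcases max_choice (x k.1.1 k.1.2.1) (x k.1.1 k.1.2.2) with h | h
    · simp only [b, h]; exact k.2.1.2
    · simp only [b, h]; exact k.2.2.1.2
  have hIooL : ∀ k, ∀ v ∈ Ioo (a k) (b k), v ∉ L := by
    intro k v hv hvL
    have hv' := Ioo_subset_Icc_self hv
    rw [← himg k] at hv'
    obtain ⟨u, hu, rfl⟩ := hv'
    have hu1 : u ≠ k.1.2.1 := by
      rintro rfl
      rcases lt_or_gt_of_ne (hne k) with h | h
      · exact hv.1.ne (min_eq_left h.le)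
      · exact hv.2.ne (max_eq_left h.le).symm
    have hu2 : u ≠ k.1.2.2 := by
      rintro rfl
      rcases lt_or_gt_of_ne (hne k) with h | h
      · exact hv.2.ne (max_eq_right h.le).symm
      · exact hv.1.ne (min_eq_right h.le)
    exact k.2.2.2.2 u ⟨lt_of_le_of_ne hu.1 hu1.symm, lt_of_le_of_ne hu.2 hu2⟩ ⟨hsub k hu, hvL⟩
  have hend : ∀ k, a k ∉ L₀ ∨ b k ∉ L₀ := by
    intro k
    by_contra! hc
    exact hIooL k ((a k + b k) / 2) ⟨by linarith [hab k], by linarith [hab k]⟩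
      (Or.inr ⟨a k, hc.1, b k, hc.2, rfl⟩)
  have hcomp : ∀ k j, StrandsCompatible a b Y Z (fun k => chord (Y k) (a k) (b k))
      (fun k => chord (Z k) (a k) (b k)) k j := by
    intro k j
    rcases Ioo_disjoint_or_eq (haL k) (hbL k) (haL j) (hbL j) (hIooL k) (hIooL j) with h | ⟨h, h'⟩
    · exact Or.inl h
    refine Or.inr ⟨h, h', ?_⟩
    have hG' : ∀ k, ∀ v ∈ Icc (a k) (b k), G k v ∈ Icc (0 : ℝ) 1 ∧ x k.1.1 (G k v) = v ∧
        y k.1.1 (G k v) = Y k v ∧ z k.1.1 (G k v) = Z k v := by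
      intro k v hv
      rw [← himg k] at hv
      obtain ⟨u, hu, rfl⟩ := hv
      have : G k (x k.1.1 u) = u := hGx k u hu
      rw [this, hYx k u hu, hZx k u hu]
      exact ⟨hsub k hu, rfl, rfl, rfl⟩
    have hloc : ∀ v ∈ Icc (a k) (b k), v ∉ L₀ → Y k v = Y j v →
        ∀ᶠ w in nhds v, w ∈ Icc (a k) (b k) → Y k w = Y j w ∧ Z k w = Z j w := by
      intro v hv hvL hYv
      obtain ⟨k1, k2, k3, k4⟩ := hG' k v hv
      obtain ⟨j1, j2, j3, j4⟩ := hG' j v (by rwa [← h, ← h'])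
      have hev := hcross k.1.1 j.1.1 _ k1 _ j1 (by rw [k2, j2])
        (by rw [k2]; exact fun hvF => hvL (Or.inl (Or.inl (Or.inl hvF)))) (by rw [k3, j3, hYv])
      have htend : Filter.Tendsto (fun w => (G k w, G j w)) (nhdsWithin v (Icc (a k) (b k)))
          (nhdsWithin (G k v, G j v) (Icc (0 : ℝ) 1 ×ˢ Icc (0 : ℝ) 1)) := by
        refine tendsto_nhdsWithin_of_tendsto_nhds_of_eventually_within _
          (((hG k).prodMk (hG j)).continuousAt.tendsto.mono_left nhdsWithin_le_nhds) ?_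
        filter_upwards [self_mem_nhdsWithin] with w hw
        exact ⟨(hG' k w hw).1, (hG' j w (by rwa [← h, ← h'])).1⟩
      have hev' := htend.eventually hev
      rw [eventually_nhdsWithin_iff] at hev'
      filter_upwards [hev'] with w hw hwI
      obtain ⟨-, l2, l3, l4⟩ := hG' k w hwI
      obtain ⟨-, m2, m3, m4⟩ := hG' j w (by rwa [← h, ← h'])
      have := hw hwI (by simp only [l2, m2])
      simpa only [l3, l4, m3, m4] using this
    have hd := strand_dichotomy (hab k) (hY k) (hZ k) (hY j) (hZ j)
      (fun v hv hvL => hIooL k v hv (hL0L hvL)) (hend k) hloc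
    simp only [← h, ← h']
    refine hd.imp_left fun heq v hv => ?_
    have e1 := heq (a k) (left_mem_Icc.2 (hab k).le)
    have e2 := heq (b k) (right_mem_Icc.2 (hab k).le)
    have e3 := heq v (Ioo_subset_Icc_self hv)
    exact ⟨e3.1, e3.2, by simp only [chord, e1.1, e2.1], by simp only [chord, e1.2, e2.2]⟩
  obtain ⟨Φ, hfix, hmove⟩ := exists_homeomorph_move_strands hab hY hZ
    (fun k => continuous_chord (Y k) (a k) (b k)) (fun k => continuous_chord (Z k) (a k) (b k))
    (fun k => chord_left _ _ _) (fun k => chord_right _ (hab k)) (fun k => chord_left _ _ _)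
    (fun k => chord_right _ (hab k)) hcomp
  refine ⟨Φ, fun i => ⟨T i, hT i, ?_, ?_, fun t ht => ht.1, ?_, ?_⟩⟩
  · exact ⟨by simp, hL0L (Or.inl (Or.inl (Or.inr ⟨i, rfl⟩)))⟩
  · exact ⟨by simp, hL0L (Or.inl (Or.inr ⟨i, rfl⟩))⟩
  · exact fun τ hτ => hfix _ fun k hk => hIooL k _ hk hτ.2
  · intro τ hτ τ' hτ' hlt hcons
    let k : κ := ⟨(i, τ, τ'), hτ, hτ', hlt, hcons⟩
    have hseg := image_chord_eq_segment (Y k) (Z k) (hab k)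
    have hΦ : ∀ v ∈ Icc (a k) (b k), Φ (v, Y k v, Z k v) =
        (v, chord (Y k) (a k) (b k) v, chord (Z k) (a k) (b k) v) := by
      intro v hv
      rcases hv.1.eq_or_lt with rfl | h1
      · rw [hfix _ fun j hj => hIooL j _ hj (haL k), chord_left, chord_left]
      rcases hv.2.eq_or_lt with rfl | h2
      · rw [hfix _ fun j hj => hIooL j _ hj (hbL k), chord_right _ (hab k), chord_right _ (hab k)]
      exact hmove k v ⟨h1, h2⟩
    have himage : (fun t => Φ (x i t, y i t, z i t)) '' Icc τ τ' =
        (fun v => Φ (v, Y k v, Z k v)) '' Icc (a k) (b k) := by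
      rw [← himg k, image_image]
      refine image_congr fun t ht => ?_
      rw [hYx k t ht, hZx k t ht]
    rw [himage, image_congr hΦ, hseg]
    have e1 : (x i τ, Y k (x i τ), Z k (x i τ)) = (x i τ, y i τ, z i τ) := by
      rw [hYx k τ (hl k), hZx k τ (hl k)]
    have e2 : (x i τ', Y k (x i τ'), Z k (x i τ')) = (x i τ', y i τ', z i τ') := by
      rw [hYx k τ' (hr k), hZx k τ' (hr k)]
    rw [← e1, ← e2]
    rcases le_total (x i τ) (x i τ') with h | h
    · have ea : a k = x i τ := min_eq_left h
      have eb : b k = x i τ' := max_eq_right h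
      rw [ea, eb]
    · have ea : a k = x i τ' := min_eq_right h
      have eb : b k = x i τ := max_eq_left h
      rw [ea, eb, segment_symm]

/-- Piecewise affine interpolation through the values `p j` at the nodes `t j`, `j ≤ k`. -/
lemma exists_piecewise_lineMap {E : Type*} [NormedAddCommGroup E] [NormedSpace ℝ E] {t : ℕ → ℝ}
    (p : ℕ → E) (k : ℕ) (ht : ∀ j < k, t j < t (j + 1)) :
    ∃ f : ℝ → E, Continuous f ∧ (∀ s, t k ≤ s → f s = p k) ∧ ∀ j < k,
      ∀ s ∈ Icc (t j) (t (j + 1)),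
        f s = AffineMap.lineMap (p j) (p (j + 1)) ((s - t j) / (t (j + 1) - t j)) := by
  induction k with
  | zero => exact ⟨fun _ => p 0, continuous_const, fun _ _ => rfl, by simp⟩
  | succ k ih =>
    obtain ⟨f, hf, hfk, hfj⟩ := ih fun j hj => ht j (hj.trans (Nat.lt_succ_self k))
    have hk := ht k (Nat.lt_succ_self k)
    have hpos : 0 < t (k + 1) - t k := by linarith
    have hmono : ∀ n, n ≤ k → t n ≤ t k := by
      intro n hn
      induction hn using Nat.decreasingInduction with
      | self => exact le_rfl
      | of_succ m hm ih => exact (ht m (by lia)).le.trans ih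
    refine ⟨fun s => f s + (max 0 (min 1 ((s - t k) / (t (k + 1) - t k)))) • (p (k + 1) - p k),
      by fun_prop, fun s hs => ?_, fun j hj s hs => ?_⟩
    · have h1 : 1 ≤ (s - t k) / (t (k + 1) - t k) := (one_le_div hpos).2 (by linarith)
      simp only [min_eq_left h1, hfk s (by linarith)]
      simp
    · rcases Nat.lt_succ_iff_lt_or_eq.1 hj with hj | rfl
      · have h0 : (s - t k) / (t (k + 1) - t k) ≤ 0 :=
          div_nonpos_of_nonpos_of_nonneg (by linarith [hs.2, hmono (j + 1) hj]) hpos.le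
        simp only [max_eq_left ((min_le_right 1 _).trans h0), hfj j hj s hs]
        simp
      · have h0 : 0 ≤ (s - t j) / (t (j + 1) - t j) := div_nonneg (by linarith [hs.1]) hpos.le
        have h1 : (s - t j) / (t (j + 1) - t j) ≤ 1 := (div_le_one hpos).2 (by linarith [hs.2])
        simp only [min_eq_right h1, max_eq_right h0, hfk s hs.1, AffineMap.lineMap_apply,
          vsub_eq_sub, vadd_eq_add]
        rw [add_comm]

lemma exists_mem_Icc_succ {t : ℕ → ℝ} {k : ℕ} (hk : 0 < k) {s : ℝ} (h0 : t 0 ≤ s)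
    (h1 : s ≤ t k) : ∃ j < k, s ∈ Icc (t j) (t (j + 1)) := by
  induction k, hk using Nat.le_induction with
  | base => exact ⟨0, by simp, h0, h1⟩
  | succ k hk ih =>
    rcases le_total s (t k) with h | h
    · obtain ⟨j, hj, hs⟩ := ih h
      exact ⟨j, hj.trans (Nat.lt_succ_self k), hs⟩
    · exact ⟨k, Nat.lt_succ_self k, h, h1⟩

/-- An arc whose pieces between consecutive points of a finite set are straight segments can be
reparametrized as a piecewise linear edge. -/
lemma exists_isPLEdge {c : ℝ → E3} (hinj : InjOn c (Icc 0 1)) {T : Set ℝ} (hT : T.Finite)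
    (h0 : 0 ∈ T) (h1 : 1 ∈ T) (hT01 : T ⊆ Icc 0 1)
    (hseg : ∀ τ ∈ T, ∀ τ' ∈ T, τ < τ' → (∀ σ ∈ Ioo τ τ', σ ∉ T) →
      c '' Icc τ τ' = segment ℝ (c τ) (c τ')) :
    ∃ f, IsPLEdge f ∧ c '' Icc 0 1 = f '' Icc 0 1 ∧ c 0 = f 0 ∧ c 1 = f 1 := by
  classical
  obtain ⟨k, hk⟩ : ∃ k, hT.toFinset.card = k + 1 :=
    Nat.exists_eq_succ_of_ne_zero (Finset.card_ne_zero_of_mem (hT.mem_toFinset.2 h0))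
  let e := hT.toFinset.orderEmbOfFin hk
  have heT : ∀ m, e m ∈ T := fun m => hT.mem_toFinset.1 (Finset.orderEmbOfFin_mem _ hk m)
  have hsurj : ∀ σ ∈ T, ∃ m, e m = σ := fun σ hσ => by
    have : σ ∈ range e := by
      rw [Finset.range_orderEmbOfFin]
      exact hT.mem_toFinset.2 hσ
    exact this
  have he0 : e 0 = 0 := by
    obtain ⟨m, hm⟩ := hsurj 0 h0
    exact le_antisymm (hm ▸ e.monotone (Fin.zero_le m)) (hT01 (heT 0)).1
  have he1 : e (Fin.last k) = 1 := by
    obtain ⟨m, hm⟩ := hsurj 1 h1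
    exact le_antisymm (hT01 (heT _)).2 (hm ▸ e.monotone (Fin.le_last m))
  have hk0 : 0 < k := by
    rcases Nat.eq_zero_or_pos k with rfl | h
    · have : e 0 = e (Fin.last 0) := rfl
      rw [he0, he1] at this
      norm_num at this
    · exact h
  let t : ℕ → ℝ := fun n => e (Fin.ofNat (k + 1) n)
  have htval : ∀ m : Fin (k + 1), t m = e m := fun m => by simp [t]
  have htcs : ∀ j : Fin k, t j = e j.castSucc := fun j => htval j.castSucc
  have hts : ∀ j : Fin k, t (j + 1) = e j.succ := fun j => htval j.succ
  have htlt : ∀ j < k, t j < t (j + 1) := fun j hj => by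
    rw [htcs ⟨j, hj⟩, hts ⟨j, hj⟩]
    exact e.strictMono (Fin.castSucc_lt_succ)
  have ht0 : t 0 = 0 := by rw [← he0]; exact htval 0
  have htk : t k = 1 := by rw [← he1]; exact htval (Fin.last k)
  have htT : ∀ n, t n ∈ T := fun n => heT _
  have hcons : ∀ j < k, ∀ σ ∈ Ioo (t j) (t (j + 1)), σ ∉ T := by
    intro j hj σ hσ hσT
    obtain ⟨m, rfl⟩ := hsurj σ hσT
    rw [htcs ⟨j, hj⟩, hts ⟨j, hj⟩] at hσ
    have h1 := e.lt_iff_lt.1 hσ.1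
    have h2 := e.lt_iff_lt.1 hσ.2
    rw [Fin.lt_def] at h1 h2
    simp at h1 h2
    lia
  have htmono : ∀ j m, j ≤ m → m ≤ k → t j ≤ t m := by
    intro j m hjm hm
    exact e.monotone (by
      rw [Fin.le_def]
      simp only [Fin.ofNat, Nat.mod_eq_of_lt (show j < k + 1 by lia),
        Nat.mod_eq_of_lt (show m < k + 1 by lia)]
      exact hjm)
  obtain ⟨f, hf, -, hfj⟩ := exists_piecewise_lineMap (fun n => c (t n)) k htlt
  have hne : ∀ j < k, c (t j) ≠ c (t (j + 1)) := fun j hj h =>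
    (htlt j hj).ne (hinj (hT01 (htT _)) (hT01 (htT _)) h)
  have hfinj : ∀ j < k, InjOn f (Icc (t j) (t (j + 1))) := by
    intro j hj s hs s' hs' h
    have hpos : t (j + 1) - t j ≠ 0 := by linarith [htlt j hj]
    rw [hfj j hj s hs, hfj j hj s' hs'] at h
    have := AffineMap.lineMap_injective ℝ (hne j hj) h
    rw [div_left_inj' hpos] at this
    linarith
  have hleft : ∀ j < k, f (t j) = c (t j) := fun j hj => by
    rw [hfj j hj _ (left_mem_Icc.2 (htlt j hj).le)]
    simp
  have hright : ∀ j < k, f (t (j + 1)) = c (t (j + 1)) := fun j hj => by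
    rw [hfj j hj _ (right_mem_Icc.2 (htlt j hj).le), div_self (by linarith [htlt j hj])]
    simp
  have himg : ∀ j < k, f '' Icc (t j) (t (j + 1)) = c '' Icc (t j) (t (j + 1)) := by
    intro j hj
    have hpos : 0 < t (j + 1) - t j := by linarith [htlt j hj]
    rw [hseg _ (htT j) _ (htT (j + 1)) (htlt j hj) (hcons j hj), segment_eq_image_lineMap]
    refine Subset.antisymm ?_ ?_
    · rintro _ ⟨s, hs, rfl⟩
      exact ⟨_, ⟨div_nonneg (by linarith [hs.1]) hpos.le,
        (div_le_one hpos).2 (by linarith [hs.2])⟩, (hfj j hj s hs).symm⟩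
    · rintro _ ⟨θ, hθ, rfl⟩
      have hs : t j + θ * (t (j + 1) - t j) ∈ Icc (t j) (t (j + 1)) :=
        ⟨by nlinarith [hθ.1], by nlinarith [hθ.2]⟩
      refine ⟨_, hs, ?_⟩
      rw [hfj j hj _ hs]
      congr 1
      field_simp
      ring
  have hcover : Icc (0 : ℝ) 1 = ⋃ j, ⋃ (_ : j < k), Icc (t j) (t (j + 1)) := by
    ext s
    simp only [mem_iUnion, exists_prop]
    constructor
    · intro hs
      exact exists_mem_Icc_succ hk0 (ht0.trans_le hs.1) (hs.2.trans_eq htk.symm)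
    · rintro ⟨j, -, hs⟩
      exact Icc_subset_Icc (hT01 (htT j)).1 (hT01 (htT (j + 1))).2 hs
  have hcross : ∀ j m s s', j < m → m < k → s ∈ Icc (t j) (t (j + 1)) →
      s' ∈ Icc (t m) (t (m + 1)) → f s = f s' → s = s' := by
    intro j m s s' hjm hm hs hs' h
    have hj : j < k := hjm.trans hm
    obtain ⟨τ, hτ, hτ'⟩ : f s ∈ c '' Icc (t j) (t (j + 1)) := himg j hj ▸ ⟨s, hs, rfl⟩
    obtain ⟨σ, hσ, hσ'⟩ : f s' ∈ c '' Icc (t m) (t (m + 1)) := himg m hm ▸ ⟨s', hs', rfl⟩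
    have hin : ∀ n, Icc (t n) (t (n + 1)) ⊆ Icc 0 1 := fun n =>
      Icc_subset_Icc (hT01 (htT n)).1 (hT01 (htT (n + 1))).2
    have hστ : τ = σ := hinj (hin j hτ) (hin m hσ) (by rw [hτ', hσ', h])
    have hjm' := htmono (j + 1) m hjm hm.le
    have e1 : τ = t (j + 1) := by linarith [hτ.2, hσ.1]
    have e2 : σ = t m := by linarith [hτ.2, hσ.1]
    have e3 : s = t (j + 1) := hfinj j hj hs (right_mem_Icc.2 (htlt j hj).le)
      (by rw [hright j hj, ← e1, hτ'])
    have e4 : s' = t m := hfinj m hm hs' (left_mem_Icc.2 (htlt m hm).le)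
      (by rw [hleft m hm, ← e2, hσ'])
    rw [e3, e4, ← e1, ← e2, hστ]
  refine ⟨f, ⟨hf.continuousOn, ?_, k, e, e.strictMono, he0, he1, fun j => ?_⟩, ?_, ?_, ?_⟩
  · intro s hs s' hs' h
    rw [hcover] at hs hs'
    simp only [mem_iUnion, exists_prop] at hs hs'
    obtain ⟨j, hj, hs⟩ := hs
    obtain ⟨m, hm, hs'⟩ := hs'
    rcases lt_trichotomy j m with hjm | rfl | hjm
    · exact hcross j m s s' hjm hm hs hs' h
    · exact hfinj j hj hs hs' h
    · exact (hcross m j s' s hjm hj hs' hs h.symm).symm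
  · refine ⟨(AffineMap.lineMap (c (t j)) (c (t (j + 1)))).comp
      (AffineMap.lineMap (-t j / (t (j + 1) - t j)) ((1 - t j) / (t (j + 1) - t j))), ?_⟩
    intro s hs
    rw [← htcs j, ← hts j] at hs
    rw [hfj j j.2 s hs, AffineMap.comp_apply]
    congr 1
    simp only [AffineMap.lineMap_apply, vsub_eq_sub, vadd_eq_add, smul_eq_mul]
    ring
  · rw [hcover, image_iUnion₂, image_iUnion₂]
    exact iUnion₂_congr fun j hj => (himg j hj).symm
  · rw [← ht0, hleft 0 hk0]
  · obtain ⟨j, rfl⟩ := Nat.exists_eq_succ_of_ne_zero hk0.ne'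
    rw [← htk, hright j (Nat.lt_succ_self j)]

/-- Puiseux parametrization of a one-sided analytic branch. -/
lemma exists_puiseux {E : Type*} [NormedAddCommGroup E] [NormedSpace ℝ E] {φ : ℝ → ℝ} {g : ℝ → E}
    (hφ : AnalyticAt ℝ φ 0) (hg : AnalyticAt ℝ g 0) (h0 : φ 0 = 0)
    (hpos : ∀ᶠ s in nhdsWithin (0 : ℝ) (Ioi 0), 0 < φ s) :
    ∃ (k : ℕ) (τ : ℝ → ℝ) (G : ℝ → E), k ≠ 0 ∧ AnalyticAt ℝ G 0 ∧
      Filter.Tendsto τ (nhdsWithin 0 (Ioi 0)) (nhds 0) ∧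
      ∀ᶠ s in nhdsWithin (0 : ℝ) (Ioi 0), 0 < τ s ∧ φ s = τ s ^ k ∧ g s = G (τ s) := by
  obtain ⟨k, u, hu, hu0, hφu⟩ := hφ.exists_eventuallyEq_pow_smul_nonzero_iff.2 (by
    intro h
    obtain ⟨s, hs, hs'⟩ := (hpos.and (h.filter_mono nhdsWithin_le_nhds)).exists
    exact hs.ne' hs')
  simp only [sub_zero, smul_eq_mul] at hφu
  have hk : k ≠ 0 := by
    rintro rfl
    have := hφu.self_of_nhds
    simp [h0] at this
    exact hu0 this.symm
  have hupos : 0 < u 0 := by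
    have h1 : ∀ᶠ s in nhdsWithin (0 : ℝ) (Ioi 0), 0 ≤ u s := by
      filter_upwards [hpos, hφu.filter_mono nhdsWithin_le_nhds, self_mem_nhdsWithin]
        with s hs hs' hs0
      rw [hs'] at hs
      exact (pos_of_mul_pos_right hs (pow_nonneg (le_of_lt hs0) _)).le
    have h2 : 0 ≤ u 0 :=
      ge_of_tendsto (hu.continuousAt.tendsto.mono_left nhdsWithin_le_nhds) h1
    exact lt_of_le_of_ne h2 (Ne.symm hu0)
  set ρ : ℝ → ℝ := fun s => Real.exp ((k : ℝ)⁻¹ * Real.log (u s)) with hρ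
  have hρa : AnalyticAt ℝ ρ 0 := (analyticAt_const.mul (hu.log hupos)).rexp
  set τ : ℝ → ℝ := fun s => s * ρ s with hτ
  have hτa : AnalyticAt ℝ τ 0 := analyticAt_id.mul hρa
  have hτ0 : τ 0 = 0 := by simp [hτ]
  have hd : deriv τ 0 ≠ 0 := by
    have : HasDerivAt τ (1 * ρ 0 + 0 * deriv ρ 0) 0 :=
      (hasDerivAt_id (0 : ℝ)).mul hρa.differentiableAt.hasDerivAt
    rw [this.deriv]
    simp [hρ]
  obtain ⟨σ, hσ, hleft⟩ : ∃ σ : ℝ → ℝ, AnalyticAt ℝ σ (τ 0) ∧ ∀ᶠ s in nhds 0, σ (τ s) = s :=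
    ⟨_, hτa.analyticAt_localInverse hd, hτa.hasStrictDerivAt.eventually_left_inverse hd⟩
  have hσ0 := hleft.self_of_nhds
  rw [hτ0] at hσ hσ0
  refine ⟨k, τ, fun w => g (σ w), hk, AnalyticAt.fun_comp (by rwa [hσ0]) hσ, ?_, ?_⟩
  · have := hτa.continuousAt.tendsto.mono_left (nhdsWithin_le_nhds (s := Ioi 0))
    rwa [hτ0] at this
  · filter_upwards [hleft.filter_mono nhdsWithin_le_nhds, hφu.filter_mono nhdsWithin_le_nhds,
      self_mem_nhdsWithin, (hu.continuousAt.eventually (lt_mem_nhds hupos)).filter_mono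
        nhdsWithin_le_nhds] with s hs hs' hs0 hus
    refine ⟨mul_pos hs0 (Real.exp_pos _), ?_, by simp [hs]⟩
    rw [hs', hτ, mul_pow, hρ]
    congr 1
    rw [← Real.exp_nat_mul, ← mul_assoc, mul_inv_cancel₀ (by exact_mod_cast hk), one_mul,
      Real.exp_log hus]

lemma AnalyticAt.eventually_pos_or_neg_right {f : ℝ → ℝ} {a : ℝ} (hf : AnalyticAt ℝ f a)
    (h : ¬ ∀ᶠ s in nhds a, f s = 0) :
    (∀ᶠ s in nhdsWithin a (Ioi a), 0 < f s) ∨ ∀ᶠ s in nhdsWithin a (Ioi a), f s < 0 := by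
  obtain ⟨k, u, hu, hu0, hfu⟩ := hf.exists_eventuallyEq_pow_smul_nonzero_iff.2 h
  rcases lt_or_gt_of_ne hu0 with hneg | hpos
  · right
    filter_upwards [hfu.filter_mono nhdsWithin_le_nhds, self_mem_nhdsWithin,
      (hu.continuousAt.eventually (gt_mem_nhds hneg)).filter_mono nhdsWithin_le_nhds]
      with s h1 h2 h3
    rw [h1]
    exact mul_neg_of_pos_of_neg (pow_pos (sub_pos.2 h2) _) h3
  · left
    filter_upwards [hfu.filter_mono nhdsWithin_le_nhds, self_mem_nhdsWithin,
      (hu.continuousAt.eventually (lt_mem_nhds hpos)).filter_mono nhdsWithin_le_nhds]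
      with s h1 h2 h3
    rw [h1]
    exact mul_pos (pow_pos (sub_pos.2 h2) _) h3

lemma IsCompact.finite_setOf_of_eventually_not {α : Type*} [TopologicalSpace α] {K : Set α}
    (hK : IsCompact K) {p : α → Prop}
    (h : ∀ t ∈ K, ∀ᶠ s in nhdsWithin t {t}ᶜ, s ∈ K → ¬ p s) : {t ∈ K | p t}.Finite := by
  by_contra hinf
  obtain ⟨t, ht, hacc⟩ := Set.Infinite.exists_accPt_of_subset_isCompact hinf hK (sep_subset _ _)
  rw [accPt_iff_frequently_nhdsNE] at hacc
  obtain ⟨s, hs, hs'⟩ := (hacc.and_eventually (h t ht)).exists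
  exact hs' hs.1 hs.2

lemma AnalyticOnNhd.finite_zeros {E : Type*} [NormedAddCommGroup E] [NormedSpace ℝ E] {f : ℝ → E}
    {U K : Set ℝ} (hf : AnalyticOnNhd ℝ f U) (hU : IsPreconnected U) (hK : IsCompact K)
    (hKU : K ⊆ U) {w : ℝ} (hw : w ∈ U) (hfw : f w ≠ 0) : {t ∈ K | f t = 0}.Finite := by
  refine hK.finite_setOf_of_eventually_not fun t ht => ?_
  rcases (hf t (hKU ht)).eventually_eq_zero_or_eventually_ne_zero with h | h
  · exact absurd (hf.eqOn_zero_of_preconnected_of_eventuallyEq_zero hU (hKU ht) h hw) hfw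
  · filter_upwards [h] with s hs _ using hs

/-- Two one-sided branches `s ↦ (φ₁ s, g₁ s)` and `t ↦ (φ₂ t, g₂ t)` either coincide, or for all but
finitely many `θ` their projections along `θ` meet over finitely many values only. -/
def BranchesGeneric (φ₁ φ₂ : ℝ → ℝ) (g₁ g₂ : ℝ → ℝ × ℝ) : Prop :=
  ∃ U ∈ nhdsWithin (0 : ℝ) (Ioi 0),
    (∀ s ∈ U, ∀ t ∈ U, φ₁ s = φ₂ t → g₁ s = g₂ t) ∨
    ∃ B : Set ℝ, B.Finite ∧ ∀ θ ∉ B, ∃ F : Set ℝ, F.Finite ∧ ∀ s ∈ U, ∀ t ∈ U, φ₁ s = φ₂ t →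
      (g₁ s).1 + θ * (g₁ s).2 = (g₂ t).1 + θ * (g₂ t).2 → φ₁ s ∈ F

lemma finite_setOf_linear_eq_zero {v : ℝ × ℝ} (hv : v ≠ 0) :
    {θ : ℝ | v.1 + θ * v.2 = 0}.Finite := by
  refine Set.Subsingleton.finite fun θ hθ θ' hθ' => ?_
  simp only [mem_ofPred_eq] at hθ hθ'
  have h2 : v.2 ≠ 0 := by
    intro h2
    rw [h2, mul_zero, add_zero] at hθ
    exact hv (Prod.ext hθ h2)
  have : (θ - θ') * v.2 = 0 := by linarith
  rcases mul_eq_zero.1 this with h | h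
  · linarith
  · exact absurd h h2

lemma branchesGeneric_of_pos {φ₁ φ₂ : ℝ → ℝ} {g₁ g₂ : ℝ → ℝ × ℝ}
    (hφ₁ : AnalyticAt ℝ φ₁ 0) (hφ₂ : AnalyticAt ℝ φ₂ 0) (hg₁ : AnalyticAt ℝ g₁ 0)
    (hg₂ : AnalyticAt ℝ g₂ 0) (h₁ : φ₁ 0 = 0) (h₂ : φ₂ 0 = 0)
    (hpos₁ : ∀ᶠ s in nhdsWithin (0 : ℝ) (Ioi 0), 0 < φ₁ s)
    (hpos₂ : ∀ᶠ s in nhdsWithin (0 : ℝ) (Ioi 0), 0 < φ₂ s) :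
    BranchesGeneric φ₁ φ₂ g₁ g₂ := by
  obtain ⟨k, τ, G, hk, hG, hτ, hev⟩ := exists_puiseux hφ₁ hg₁ h₁ hpos₁
  obtain ⟨l, υ, H, hl, hH, hυ, hev'⟩ := exists_puiseux hφ₂ hg₂ h₂ hpos₂
  set D : ℝ → ℝ × ℝ := fun w => G (w ^ l) - H (w ^ k) with hD
  have hDa : AnalyticAt ℝ D 0 := by
    refine AnalyticAt.sub (AnalyticAt.fun_comp (f := fun w : ℝ => w ^ l) ?_ (analyticAt_id.pow l))
      (AnalyticAt.fun_comp (f := fun w : ℝ => w ^ k) ?_ (analyticAt_id.pow k))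
    · simpa [hl] using hG
    · simpa [hk] using hH
  obtain ⟨ρ, hρ, hball⟩ := Metric.eventually_nhds_iff_ball.1 hDa.eventually_analyticAt
  set U : Set ℝ := {s | (0 < τ s ∧ φ₁ s = τ s ^ k ∧ g₁ s = G (τ s)) ∧
    (0 < υ s ∧ φ₂ s = υ s ^ l ∧ g₂ s = H (υ s)) ∧ τ s < (ρ / 2) ^ l} with hU
  have hUmem : U ∈ nhdsWithin (0 : ℝ) (Ioi 0) := by
    filter_upwards [hev, hev', hτ.eventually (gt_mem_nhds (by positivity : 0 < (ρ / 2) ^ l))]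
      with s a b c using ⟨a, b, c⟩
  have key : ∀ s ∈ U, ∀ t ∈ U, φ₁ s = φ₂ t → ∃ w ∈ Icc (0 : ℝ) (ρ / 2),
      φ₁ s = w ^ (l * k) ∧ D w = g₁ s - g₂ t := by
    rintro s ⟨⟨a1, a2, a3⟩, -, a4⟩ t ⟨-, ⟨b1, b2, b3⟩, -⟩ hst
    set w : ℝ := τ s ^ (l : ℝ)⁻¹ with hw
    have hw0 : 0 ≤ w := by positivity
    have hwl : w ^ l = τ s := Real.rpow_inv_natCast_pow a1.le hl
    have hwk : w ^ k = υ t := by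
      have : (w ^ k) ^ l = υ t ^ l := by rw [← b2, ← hst, a2, ← hwl, ← pow_mul, ← pow_mul, mul_comm]
      exact (pow_left_inj₀ (by positivity) b1.le hl).1 this
    refine ⟨w, ⟨hw0, ?_⟩, ?_, ?_⟩
    · exact (lt_of_pow_lt_pow_left₀ l (by positivity) (hwl ▸ a4)).le
    · rw [a2, pow_mul, hwl]
    · rw [hD, a3, b3, ← hwl, ← hwk]
  have hK : Icc 0 (ρ / 2) ⊆ Metric.ball (0 : ℝ) ρ := by
    intro w hw
    rw [Metric.mem_ball, Real.dist_eq, sub_zero, abs_of_nonneg hw.1]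
    linarith [hw.2]
  refine ⟨U, hUmem, ?_⟩
  by_cases hzero : ∀ w ∈ Metric.ball (0 : ℝ) ρ, D w = 0
  · left
    intro s hs t ht hst
    obtain ⟨w, hw, -, hw'⟩ := key s hs t ht hst
    rw [hzero w (hK hw)] at hw'
    exact (sub_eq_zero.1 hw'.symm)
  · right
    push Not at hzero
    obtain ⟨w₀, hw₀, hDw₀⟩ := hzero
    refine ⟨_, finite_setOf_linear_eq_zero hDw₀, fun θ hθ => ?_⟩
    have hfa : AnalyticOnNhd ℝ (fun w => (D w).1 + θ * (D w).2) (Metric.ball 0 ρ) := fun w hw => by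
      have h1 : AnalyticAt ℝ (fun w => (D w).1) w :=
        AnalyticAt.fun_comp analyticAt_fst (hball w hw)
      have h2 : AnalyticAt ℝ (fun w => (D w).2) w :=
        AnalyticAt.fun_comp analyticAt_snd (hball w hw)
      exact h1.add (analyticAt_const.mul h2)
    refine ⟨_, (hfa.finite_zeros (convex_ball _ _).isPreconnected isCompact_Icc hK hw₀ hθ).image
      (fun w => w ^ (l * k)), fun s hs t ht hst heq => ?_⟩
    obtain ⟨w, hw, hw1, hw2⟩ := key s hs t ht hst
    refine ⟨w, ⟨hw, ?_⟩, hw1.symm⟩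
    simp only [hw2, Prod.fst_sub, Prod.snd_sub]
    linarith

lemma branchesGeneric {ξ₁ ξ₂ : ℝ → ℝ} {g₁ g₂ : ℝ → ℝ × ℝ}
    (hξ₁ : AnalyticAt ℝ ξ₁ 0) (hξ₂ : AnalyticAt ℝ ξ₂ 0) (hg₁ : AnalyticAt ℝ g₁ 0)
    (hg₂ : AnalyticAt ℝ g₂ 0) (h₁ : ¬ ∀ᶠ s in nhds 0, ξ₁ s = ξ₁ 0)
    (h₂ : ¬ ∀ᶠ s in nhds 0, ξ₂ s = ξ₂ 0) : BranchesGeneric ξ₁ ξ₂ g₁ g₂ := by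
  have vac : ∀ U ∈ nhdsWithin (0 : ℝ) (Ioi 0), (∀ s ∈ U, ∀ t ∈ U, ξ₁ s ≠ ξ₂ t) →
      BranchesGeneric ξ₁ ξ₂ g₁ g₂ := fun U hU h =>
    ⟨U, hU, Or.inl fun s hs t ht hst => absurd hst (h s hs t ht)⟩
  by_cases h0 : ξ₁ 0 = ξ₂ 0
  swap
  · obtain ⟨V, W, hV, hW, hV0, hW0, hVW⟩ := t2_separation h0
    refine vac (ξ₁ ⁻¹' V ∩ ξ₂ ⁻¹' W) ?_ fun s hs t ht hst =>
      Set.disjoint_left.1 hVW hs.1 (by rw [hst]; exact ht.2)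
    exact nhdsWithin_le_nhds (Filter.inter_mem
      (hξ₁.continuousAt.preimage_mem_nhds (hV.mem_nhds hV0))
      (hξ₂.continuousAt.preimage_mem_nhds (hW.mem_nhds hW0)))
  have hs₁ := (hξ₁.sub (analyticAt_const (v := ξ₁ 0))).eventually_pos_or_neg_right
    (by simpa [sub_eq_zero] using h₁)
  have hs₂ := (hξ₂.sub (analyticAt_const (v := ξ₂ 0))).eventually_pos_or_neg_right
    (by simpa [sub_eq_zero] using h₂)
  simp only [Pi.sub_apply, sub_pos, sub_neg] at hs₁ hs₂
  have mixed : ∀ η : ℝ, η ≠ 0 → (∀ᶠ s in nhdsWithin (0 : ℝ) (Ioi 0), 0 < η * (ξ₁ s - ξ₁ 0)) →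
      (∀ᶠ s in nhdsWithin (0 : ℝ) (Ioi 0), 0 < η * (ξ₂ s - ξ₂ 0)) →
      BranchesGeneric ξ₁ ξ₂ g₁ g₂ := by
    intro η hη p₁ p₂
    obtain ⟨U, hU, h⟩ := branchesGeneric_of_pos (φ₁ := fun s => η * (ξ₁ s - ξ₁ 0))
      (φ₂ := fun s => η * (ξ₂ s - ξ₂ 0)) (analyticAt_const.mul (hξ₁.sub analyticAt_const))
      (analyticAt_const.mul (hξ₂.sub analyticAt_const)) hg₁ hg₂ (by simp) (by simp) p₁ p₂
    refine ⟨U, hU, h.imp (fun h s hs t ht hst => h s hs t ht (by simp only [hst, h0])) ?_⟩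
    rintro ⟨B, hB, h⟩
    refine ⟨B, hB, fun θ hθ => ?_⟩
    obtain ⟨F, hF, h⟩ := h θ hθ
    refine ⟨(fun c => η⁻¹ * c + ξ₁ 0) '' F, hF.image _, fun s hs t ht hst heq =>
      ⟨_, h s hs t ht (by simp only [hst, h0]) heq, ?_⟩⟩
    field_simp
    ring
  rcases hs₁ with p₁ | p₁ <;> rcases hs₂ with p₂ | p₂
  · exact mixed 1 one_ne_zero (by simpa using p₁) (by simpa using p₂)
  · exact vac _ (p₁.and p₂) fun s hs t ht hst => by
      have h1 := hs.1; have h2 := ht.2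
      linarith
  · exact vac _ (p₁.and p₂) fun s hs t ht hst => by
      have h1 := hs.1; have h2 := ht.2
      linarith
  · exact mixed (-1) (by norm_num) (by simpa using p₁) (by simpa using p₂)

/-- On each side of every parameter in `[0, 1]`, the curve `(x, r)` is given by analytic germs, and
the germ of `x` is not constant. -/
def BranchRegular (x : ℝ → ℝ) (r : ℝ → ℝ × ℝ) : Prop :=
  ∀ t₀ ∈ Icc (0 : ℝ) 1, ∀ δ : ℝ, |δ| = 1 → ∃ (ξ : ℝ → ℝ) (g : ℝ → ℝ × ℝ), AnalyticAt ℝ ξ 0 ∧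
    AnalyticAt ℝ g 0 ∧ (¬ ∀ᶠ s in nhds 0, ξ s = ξ 0) ∧
    ∀ᶠ s in nhdsWithin (0 : ℝ) (Ioi 0), t₀ + δ * s ∈ Icc (0 : ℝ) 1 →
      x (t₀ + δ * s) = ξ s ∧ r (t₀ + δ * s) = g s

lemma exists_pos_forall_Ioo {p : ℝ → Prop} (h : ∀ᶠ s in nhdsWithin (0 : ℝ) (Ioi 0), p s) :
    ∃ ε > 0, ∀ s ∈ Ioo 0 ε, p s := by
  obtain ⟨ε, hε, h⟩ := mem_nhdsGT_iff_exists_Ioo_subset.1 h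
  exact ⟨ε, hε, h⟩

lemma eventually_nhdsNE_of_sides {p : ℝ → Prop} {t₀ : ℝ}
    (h : ∀ δ : ℝ, |δ| = 1 → ∃ ε > 0, ∀ s ∈ Ioo 0 ε, p (t₀ + δ * s)) :
    ∀ᶠ t in nhdsWithin t₀ {t₀}ᶜ, p t := by
  obtain ⟨ε, hε, h1⟩ := h 1 (by simp)
  obtain ⟨ε', hε', h2⟩ := h (-1) (by simp)
  rw [eventually_nhdsWithin_iff]
  filter_upwards [Ioo_mem_nhds (show t₀ - ε' < t₀ by linarith) (show t₀ < t₀ + ε by linarith)]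
    with t ht hne
  rcases lt_or_gt_of_ne hne with hlt | hgt
  · simpa using h2 (t₀ - t) ⟨by linarith, by linarith [ht.1]⟩
  · simpa using h1 (t - t₀) ⟨by linarith, by linarith [ht.2]⟩

lemma mul_self_of_abs_eq_one {δ : ℝ} (hδ : |δ| = 1) : δ * δ = 1 := by
  rw [← abs_mul_abs_self, hδ, one_mul]

namespace BranchRegular

lemma finite_fiber {x : ℝ → ℝ} {r : ℝ → ℝ × ℝ} (h : BranchRegular x r) (c : ℝ) :
    {t ∈ Icc (0 : ℝ) 1 | x t = c}.Finite := by
  refine isCompact_Icc.finite_setOf_of_eventually_not fun t₀ ht₀ =>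
    eventually_nhdsNE_of_sides fun δ hδ => ?_
  obtain ⟨ξ, g, hξ, -, hnc, hev⟩ := h t₀ ht₀ δ hδ
  apply exists_pos_forall_Ioo
  rcases hξ.eventually_eq_or_eventually_ne (analyticAt_const (v := c)) with hc | hc
  · refine absurd ?_ hnc
    filter_upwards [hc] with s hs
    rw [hs, hc.self_of_nhds]
  · filter_upwards [hev, hc.filter_mono (nhdsGT_le_nhdsNE _)]
      with s h1 h2 h3
    rw [(h1 h3).1]
    exact h2

lemma finite_extr {x : ℝ → ℝ} {r : ℝ → ℝ × ℝ} (h : BranchRegular x r) :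
    {t ∈ Ioo (0 : ℝ) 1 | IsLocalExtr x t}.Finite := by
  have key : {t ∈ Icc (0 : ℝ) 1 | t ∈ Ioo (0 : ℝ) 1 ∧ IsLocalExtr x t}.Finite := by
    refine isCompact_Icc.finite_setOf_of_eventually_not fun t₀ ht₀ =>
      eventually_nhdsNE_of_sides fun δ hδ => ?_
    obtain ⟨ξ, g, hξ, -, hnc, hev⟩ := h t₀ ht₀ δ hδ
    have hδ2 := mul_self_of_abs_eq_one hδ
    have hd : ∀ᶠ s in nhdsWithin (0 : ℝ) {0}ᶜ, deriv ξ s ≠ 0 := by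
      refine (hξ.deriv.eventually_eq_zero_or_eventually_ne_zero).resolve_left fun hz => hnc ?_
      obtain ⟨ε, hε, hball⟩ := Metric.eventually_nhds_iff_ball.1 (hz.and hξ.eventually_analyticAt)
      filter_upwards [Metric.ball_mem_nhds 0 hε] with s hs
      exact (convex_ball (0 : ℝ) ε).is_const_of_fderivWithin_eq_zero (𝕜 := ℝ)
        (fun u hu => (hball u hu).2.differentiableAt.differentiableWithinAt)
        (fun u hu => by
          rw [fderivWithin_of_isOpen Metric.isOpen_ball hu]
          ext
          simpa using (hball u hu).1)
        hs (Metric.mem_ball_self hε)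
    obtain ⟨ε, hε, hgood⟩ := exists_pos_forall_Ioo (hev.and
      ((hd.and (hξ.eventually_analyticAt.filter_mono nhdsWithin_le_nhds)).filter_mono
        (nhdsGT_le_nhdsNE _)))
    refine ⟨ε, hε, fun s hs _ hbad => ?_⟩
    obtain ⟨hIoo, hext⟩ := hbad
    obtain ⟨-, hds, has⟩ := hgood s hs
    have hcts : Filter.Tendsto (fun t => δ * (t - t₀)) (nhds (t₀ + δ * s)) (nhds s) := by
      have : ContinuousAt (fun t => δ * (t - t₀)) (t₀ + δ * s) := by fun_prop
      have h2 := this.tendsto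
      rwa [show δ * (t₀ + δ * s - t₀) = s by linear_combination s * hδ2] at h2
    have heq : x =ᶠ[nhds (t₀ + δ * s)] fun t => ξ (δ * (t - t₀)) := by
      filter_upwards [hcts.eventually (Ioo_mem_nhds hs.1 hs.2), Ioo_mem_nhds hIoo.1 hIoo.2]
        with t ht ht'
      have e1 : t₀ + δ * (δ * (t - t₀)) = t := by linear_combination (t - t₀) * hδ2
      have := ((hgood _ ht).1 (by rw [e1]; exact Ioo_subset_Icc_self ht')).1
      rwa [e1] at this
    have hder : HasDerivAt (fun t => ξ (δ * (t - t₀))) (deriv ξ s * δ) (t₀ + δ * s) := by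
      have h1 : HasDerivAt (fun t => δ * (t - t₀)) δ (t₀ + δ * s) := by
        simpa using ((hasDerivAt_id (t₀ + δ * s)).sub_const t₀).const_mul δ
      have h2 : HasDerivAt ξ (deriv ξ s) (δ * (t₀ + δ * s - t₀)) := by
        rw [show δ * (t₀ + δ * s - t₀) = s by linear_combination s * hδ2]
        exact has.differentiableAt.hasDerivAt
      exact h2.comp (t₀ + δ * s) h1
    have h0 := hext.hasDerivAt_eq_zero (hder.congr_of_eventuallyEq heq)
    rcases mul_eq_zero.1 h0 with h0 | h0
    · exact hds h0
    · rw [h0] at hδ2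
      norm_num at hδ2
  exact key.subset fun t ht => ⟨Ioo_subset_Icc_self ht.1, ht⟩

/-- For all but finitely many `θ`, two branch-regular curves satisfy the crossing condition over all
values of `x` outside a finite set. -/
lemma exists_finite_crossings {x x' : ℝ → ℝ} {r r' : ℝ → ℝ × ℝ} (h : BranchRegular x r)
    (h' : BranchRegular x' r') : ∃ B : Set ℝ, B.Finite ∧ ∀ θ ∉ B, ∃ F : Set ℝ, F.Finite ∧
      ∀ q ∈ Icc (0 : ℝ) 1 ×ˢ Icc (0 : ℝ) 1, x q.1 = x' q.2 → x q.1 ∉ F →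
        (r q.1).1 + θ * (r q.1).2 = (r' q.2).1 + θ * (r' q.2).2 →
        ∀ᶠ p in nhdsWithin q (Icc (0 : ℝ) 1 ×ˢ Icc (0 : ℝ) 1), x p.1 = x' p.2 →
          r p.1 = r' p.2 := by
  set K := Icc (0 : ℝ) 1 ×ˢ Icc (0 : ℝ) 1 with hKdef
  set P : Set (ℝ × ℝ) → Prop := fun S => ∃ B : Set ℝ, B.Finite ∧ ∀ θ ∉ B, ∃ F : Set ℝ, F.Finite ∧
      ∀ q ∈ S, x q.1 = x' q.2 → x q.1 ∉ F →
        (r q.1).1 + θ * (r q.1).2 = (r' q.2).1 + θ * (r' q.2).2 →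
        ∀ᶠ p in nhdsWithin q K, x p.1 = x' p.2 → r p.1 = r' p.2 with hP
  have hmono : ∀ ⦃S T : Set (ℝ × ℝ)⦄, S ⊆ T → P T → P S := by
    rintro S T hST ⟨B, hB, hT⟩
    refine ⟨B, hB, fun θ hθ => ?_⟩
    obtain ⟨F, hF, hT⟩ := hT θ hθ
    exact ⟨F, hF, fun q hq => hT q (hST hq)⟩
  have hunion : ∀ ⦃S T : Set (ℝ × ℝ)⦄, P S → P T → P (S ∪ T) := by
    rintro S T ⟨B, hB, hS⟩ ⟨C, hC, hT⟩
    refine ⟨B ∪ C, hB.union hC, fun θ hθ => ?_⟩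
    obtain ⟨F, hF, hS⟩ := hS θ fun hB => hθ (Or.inl hB)
    obtain ⟨G, hG, hT⟩ := hT θ fun hC => hθ (Or.inr hC)
    refine ⟨F ∪ G, hF.union hG, ?_⟩
    rintro q (hq | hq) hxx hxF
    · exact hS q hq hxx fun hF => hxF (Or.inl hF)
    · exact hT q hq hxx fun hG => hxF (Or.inr hG)
  refine (isCompact_Icc.prod isCompact_Icc).induction_on (p := P)
    ⟨∅, finite_empty, fun θ _ => ⟨∅, finite_empty, fun q hq => hq.elim⟩⟩ hmono hunion ?_
  rintro ⟨s₀, t₀⟩ ⟨hs₀, ht₀⟩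
  have hline : P {q | q.1 = s₀ ∨ q.2 = t₀} := by
    refine ⟨∅, finite_empty, fun θ _ => ⟨{x s₀, x' t₀}, by simp, ?_⟩⟩
    rintro q (hq | hq) hxx hxF
    · exact absurd (Or.inl (by rw [hq])) hxF
    · exact absurd (Or.inr (by rw [hxx, hq]; rfl)) hxF
  have hquad : ∀ δ δ' : ℝ, |δ| = 1 → |δ'| = 1 → ∃ ε > 0,
      P ({q | δ * (q.1 - s₀) ∈ Ioo 0 ε ∧ δ' * (q.2 - t₀) ∈ Ioo 0 ε} ∩ K) := by
    intro δ δ' hδ hδ'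
    obtain ⟨ξ, g, hξ, hg, hnc, hev⟩ := h s₀ hs₀ δ hδ
    obtain ⟨ξ', g', hξ', hg', hnc', hev'⟩ := h' t₀ ht₀ δ' hδ'
    obtain ⟨U, hU, hgen⟩ := branchesGeneric hξ hξ' hg hg' hnc hnc'
    obtain ⟨ε, hε, hall⟩ := exists_pos_forall_Ioo ((hev.and hev').and hU)
    refine ⟨ε, hε, ?_⟩
    set Q : Set (ℝ × ℝ) := {q | δ * (q.1 - s₀) ∈ Ioo 0 ε ∧ δ' * (q.2 - t₀) ∈ Ioo 0 ε} with hQ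
    have hQo : IsOpen Q :=
      (isOpen_Ioo.preimage (by fun_prop)).inter (isOpen_Ioo.preimage (by fun_prop))
    have hδ2 := mul_self_of_abs_eq_one hδ
    have hδ2' := mul_self_of_abs_eq_one hδ'
    have hval : ∀ q ∈ Q ∩ K, δ * (q.1 - s₀) ∈ U ∧ δ' * (q.2 - t₀) ∈ U ∧
        (x q.1 = ξ (δ * (q.1 - s₀)) ∧ r q.1 = g (δ * (q.1 - s₀))) ∧
        (x' q.2 = ξ' (δ' * (q.2 - t₀)) ∧ r' q.2 = g' (δ' * (q.2 - t₀))) := by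
      rintro q ⟨hq, hqK⟩
      have e1 : s₀ + δ * (δ * (q.1 - s₀)) = q.1 := by linear_combination (q.1 - s₀) * hδ2
      have e2 : t₀ + δ' * (δ' * (q.2 - t₀)) = q.2 := by linear_combination (q.2 - t₀) * hδ2'
      have a1 := (hall _ hq.1).1.1
      have a2 := (hall _ hq.2).1.2
      rw [e1] at a1
      rw [e2] at a2
      exact ⟨(hall _ hq.1).2, (hall _ hq.2).2, a1 hqK.1, a2 hqK.2⟩
    rcases hgen with hgen | ⟨B, hB, hgen⟩
    · refine ⟨∅, finite_empty, fun θ _ => ⟨∅, finite_empty, fun q hq _ _ _ => ?_⟩⟩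
      rw [eventually_nhdsWithin_iff]
      filter_upwards [hQo.mem_nhds hq.1] with p hp hpK hxx
      obtain ⟨u1, u2, ⟨v1, v2⟩, w1, w2⟩ := hval p ⟨hp, hpK⟩
      rw [v2, w2]
      exact hgen _ u1 _ u2 (by rw [← v1, ← w1, hxx])
    · refine ⟨B, hB, fun θ hθ => ?_⟩
      obtain ⟨F, hF, hgen⟩ := hgen θ hθ
      refine ⟨F, hF, fun q hq hxx hxF heq => ?_⟩
      obtain ⟨u1, u2, ⟨v1, v2⟩, w1, w2⟩ := hval q hq
      refine absurd ?_ hxF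
      rw [v1]
      exact hgen _ u1 _ u2 (by rw [← v1, ← w1, hxx]) (by rw [← v2, ← w2]; exact heq)
  obtain ⟨ε₁, hε₁, h1⟩ := hquad 1 1 (by simp) (by simp)
  obtain ⟨ε₂, hε₂, h2⟩ := hquad 1 (-1) (by simp) (by simp)
  obtain ⟨ε₃, hε₃, h3⟩ := hquad (-1) 1 (by simp) (by simp)
  obtain ⟨ε₄, hε₄, h4⟩ := hquad (-1) (-1) (by simp) (by simp)
  refine ⟨_, ?_, hunion hline (hunion (hunion h1 h2) (hunion h3 h4))⟩
  obtain ⟨ε, hε, l1, l2, l3, l4⟩ : ∃ ε > 0, ε ≤ ε₁ ∧ ε ≤ ε₂ ∧ ε ≤ ε₃ ∧ ε ≤ ε₄ :=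
    ⟨min (min ε₁ ε₂) (min ε₃ ε₄), by positivity, by simp, by simp, by simp, by simp⟩
  have hnear : Ioo (s₀ - ε) (s₀ + ε) ×ˢ Ioo (t₀ - ε) (t₀ + ε) ∈ nhds (s₀, t₀) :=
    prod_mem_nhds (Ioo_mem_nhds (by linarith) (by linarith))
      (Ioo_mem_nhds (by linarith) (by linarith))
  filter_upwards [nhdsWithin_le_nhds hnear, self_mem_nhdsWithin] with q hq hqK
  obtain ⟨⟨a1, a2⟩, b1, b2⟩ := hq
  rcases lt_trichotomy q.1 s₀ with hs | hs | hs
  · rcases lt_trichotomy q.2 t₀ with ht | ht | ht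
    · refine Or.inr (Or.inr (Or.inr ⟨⟨⟨?_, ?_⟩, ?_, ?_⟩, hqK⟩)) <;> linarith
    · exact Or.inl (Or.inr ht)
    · refine Or.inr (Or.inr (Or.inl ⟨⟨⟨?_, ?_⟩, ?_, ?_⟩, hqK⟩)) <;> linarith
  · exact Or.inl (Or.inl hs)
  · rcases lt_trichotomy q.2 t₀ with ht | ht | ht
    · refine Or.inr (Or.inl (Or.inr ⟨⟨⟨?_, ?_⟩, ?_, ?_⟩, hqK⟩)) <;> linarith
    · exact Or.inl (Or.inr ht)
    · refine Or.inr (Or.inl (Or.inl ⟨⟨⟨?_, ?_⟩, ?_, ?_⟩, hqK⟩)) <;> linarith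

end BranchRegular

/-- The linear functional `v ↦ v₀ + θ v₁ + θ² v₂`. -/
def momentForm (θ : ℝ) : E3 →L[ℝ] ℝ :=
  ContinuousLinearMap.proj 0 + θ • ContinuousLinearMap.proj 1 + θ ^ 2 • ContinuousLinearMap.proj 2

lemma momentForm_apply (θ : ℝ) (v : E3) : momentForm θ v = v 0 + θ * v 1 + θ ^ 2 * v 2 := by
  simp [momentForm]

lemma finite_setOf_momentForm_eq_zero {v : E3} (hv : v ≠ 0) :
    {θ : ℝ | momentForm θ v = 0}.Finite := by
  set p : Polynomial ℝ := .C (v 0) + .C (v 1) * .X + .C (v 2) * .X ^ 2 with hp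
  have hp0 : p ≠ 0 := by
    intro h
    apply hv
    have c0 : p.coeff 0 = 0 := by simp [h]
    have c1 : p.coeff 1 = 0 := by simp [h]
    have c2 : p.coeff 2 = 0 := by simp [h]
    simp [hp, Polynomial.coeff_X, Polynomial.coeff_C] at c0 c1 c2
    ext i
    fin_cases i
    · exact c0
    · exact c1
    · exact c2
  refine (p.finite_setOfPred_isRoot hp0).subset fun θ hθ => ?_
  have hθ' : momentForm θ v = 0 := hθ
  rw [momentForm_apply] at hθ'
  simp only [mem_ofPred_eq, Polynomial.IsRoot.def, hp, Polynomial.eval_add, Polynomial.eval_mul,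
    Polynomial.eval_C, Polynomial.eval_X, Polynomial.eval_pow]
  linarith

lemma exists_castSucc_le_lt_succ {k : ℕ} {t : Fin (k + 1) → ℝ} {s : ℝ} (h0 : t 0 ≤ s)
    (h1 : s < t (Fin.last k)) : ∃ j : Fin k, t j.castSucc ≤ s ∧ s < t j.succ := by
  by_contra! h
  exact (Fin.induction (motive := fun i => t i ≤ s) h0 h (Fin.last k)).not_gt h1

lemma exists_castSucc_lt_le_succ {k : ℕ} {t : Fin (k + 1) → ℝ} {s : ℝ} (h0 : t 0 < s)
    (h1 : s ≤ t (Fin.last k)) : ∃ j : Fin k, t j.castSucc < s ∧ s ≤ t j.succ := by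
  by_contra! h
  exact (Fin.induction (motive := fun i => t i < s) h0 h (Fin.last k)).not_ge h1

/-- For all but finitely many shears, a piecewise analytic edge is branch-regular. -/
lemma IsPAEdge.exists_finite_branchRegular {e : ℝ → E3} (he : IsPAEdge e) :
    ∃ B : Set ℝ, B.Finite ∧ ∀ θ ∉ B,
      BranchRegular (fun t => momentForm θ (e t)) (fun t => (e t 1, e t 2)) := by
  obtain ⟨-, hinj, k, t, ht, ht0, ht1, hpiece⟩ := he
  have htI : ∀ i, t i ∈ Icc (0 : ℝ) 1 := fun i =>
    ⟨ht0 ▸ ht.monotone (Fin.zero_le i), ht1 ▸ ht.monotone (Fin.le_last i)⟩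
  have hlt : ∀ j : Fin k, t j.castSucc < t j.succ := fun j => ht (Fin.castSucc_lt_succ)
  refine ⟨⋃ j : Fin k, {θ | momentForm θ (e (t j.succ) - e (t j.castSucc)) = 0},
    finite_iUnion fun j => finite_setOf_momentForm_eq_zero (sub_ne_zero.2 fun h =>
      (hlt j).ne' (hinj (htI _) (htI _) h)), fun θ hθ => ?_⟩
  have piece : ∀ (j : Fin k) (t₀ δ : ℝ), |δ| = 1 → t₀ ∈ Icc (t j.castSucc) (t j.succ) →
      (∀ᶠ s in nhdsWithin (0 : ℝ) (Ioi 0), t₀ + δ * s ∈ Icc (t j.castSucc) (t j.succ)) →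
      ∃ (ξ : ℝ → ℝ) (g : ℝ → ℝ × ℝ), AnalyticAt ℝ ξ 0 ∧ AnalyticAt ℝ g 0 ∧
        (¬ ∀ᶠ s in nhds 0, ξ s = ξ 0) ∧
        ∀ᶠ s in nhdsWithin (0 : ℝ) (Ioi 0), t₀ + δ * s ∈ Icc (0 : ℝ) 1 →
          momentForm θ (e (t₀ + δ * s)) = ξ s ∧ (e (t₀ + δ * s) 1, e (t₀ + δ * s) 2) = g s := by
    intro j t₀ δ hδ ht₀ hev
    obtain ⟨u, v, g, hu, hv, hg, hEq⟩ := hpiece j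
    have hsub : Icc (t j.castSucc) (t j.succ) ⊆ Ioo u v := fun s hs =>
      ⟨hu.trans_le hs.1, hs.2.trans_lt hv⟩
    have hga : AnalyticAt ℝ (fun s => g (t₀ + δ * s)) 0 := by
      refine AnalyticAt.fun_comp (f := fun s => t₀ + δ * s) ?_
        (analyticAt_const.add (analyticAt_const.mul analyticAt_id))
      simpa using hg t₀ (hsub ht₀)
    have hcoord : ∀ i, AnalyticAt ℝ (fun s => g (t₀ + δ * s) i) 0 := fun i =>
      AnalyticAt.fun_comp
        ((ContinuousLinearMap.proj (R := ℝ) (φ := fun _ : Fin 3 => ℝ) i).analyticAt _) hga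
    refine ⟨fun s => momentForm θ (g (t₀ + δ * s)), fun s => (g (t₀ + δ * s) 1, g (t₀ + δ * s) 2),
      AnalyticAt.fun_comp ((momentForm θ).analyticAt _) hga, (hcoord 1).prod (hcoord 2), ?_, ?_⟩
    · intro hconst
      apply hθ
      have hδ2 := mul_self_of_abs_eq_one hδ
      have hcts : Filter.Tendsto (fun s => δ * (s - t₀)) (nhds t₀) (nhds 0) := by
        have : ContinuousAt (fun s => δ * (s - t₀)) t₀ := by fun_prop
        simpa using this.tendsto
      have hloc : (fun s => momentForm θ (g s)) =ᶠ[nhds t₀] fun _ => momentForm θ (g t₀) := by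
        filter_upwards [hcts.eventually hconst] with s hs
        rw [show t₀ + δ * (δ * (s - t₀)) = s by linear_combination (s - t₀) * hδ2] at hs
        simpa using hs
      have hall := AnalyticOnNhd.eqOn_of_preconnected_of_eventuallyEq (U := Ioo u v)
        (fun s hs => AnalyticAt.fun_comp ((momentForm θ).analyticAt _) (hg s hs))
        (fun s hs => analyticAt_const) isPreconnected_Ioo (hsub ht₀) hloc
      refine mem_iUnion.2 ⟨j, ?_⟩
      have m1 : t j.castSucc ∈ Icc (t j.castSucc) (t j.succ) := ⟨le_rfl, (hlt j).le⟩
      have m2 : t j.succ ∈ Icc (t j.castSucc) (t j.succ) := ⟨(hlt j).le, le_rfl⟩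
      have a1 := hall (hsub m1)
      have a2 := hall (hsub m2)
      simp only at a1 a2
      simp only [mem_ofPred_eq, map_sub, hEq m1, hEq m2, a1, a2, sub_self]
    · filter_upwards [hev] with s hs _
      rw [hEq hs]
      exact ⟨rfl, rfl⟩
  have vac : ∀ t₀ δ : ℝ, (∀ s > 0, t₀ + δ * s ∉ Icc (0 : ℝ) 1) →
      ∃ (ξ : ℝ → ℝ) (g : ℝ → ℝ × ℝ), AnalyticAt ℝ ξ 0 ∧ AnalyticAt ℝ g 0 ∧
        (¬ ∀ᶠ s in nhds 0, ξ s = ξ 0) ∧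
        ∀ᶠ s in nhdsWithin (0 : ℝ) (Ioi 0), t₀ + δ * s ∈ Icc (0 : ℝ) 1 →
          momentForm θ (e (t₀ + δ * s)) = ξ s ∧ (e (t₀ + δ * s) 1, e (t₀ + δ * s) 2) = g s := by
    intro t₀ δ hout
    refine ⟨id, fun _ => 0, analyticAt_id, analyticAt_const, fun h => ?_, ?_⟩
    · obtain ⟨s, hs, hs'⟩ := ((h.filter_mono (nhdsWithin_le_nhds (s := Ioi 0))).and
        self_mem_nhdsWithin).exists
      exact (ne_of_gt hs') hs
    · filter_upwards [self_mem_nhdsWithin] with s hs hs'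
      exact absurd hs' (hout s hs)
  intro t₀ ht₀ δ hδ
  rcases eq_or_eq_neg_of_abs_eq hδ with rfl | rfl
  · rcases ht₀.2.lt_or_eq with h1 | h1
    · obtain ⟨j, hj, hj'⟩ := exists_castSucc_le_lt_succ (ht0.trans_le ht₀.1) (h1.trans_eq ht1.symm)
      refine piece j t₀ 1 hδ ⟨hj, hj'.le⟩ ?_
      filter_upwards [Ioo_mem_nhdsGT (sub_pos.2 hj')] with s hs
      exact ⟨by linarith [hs.1], by linarith [hs.2]⟩
    · exact vac t₀ 1 fun s hs hmem => by linarith [hmem.2]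
  · rcases ht₀.1.lt_or_eq with h0 | h0
    · obtain ⟨j, hj, hj'⟩ := exists_castSucc_lt_le_succ (ht0.trans_lt h0) (ht₀.2.trans_eq ht1.symm)
      refine piece j t₀ (-1) hδ ⟨hj.le, hj'⟩ ?_
      filter_upwards [Ioo_mem_nhdsGT (sub_pos.2 hj)] with s hs
      exact ⟨by linarith [hs.2], by linarith [hs.1]⟩
    · exact vac t₀ (-1) fun s hs hmem => by linarith [hmem.1]

/-- The shear `v ↦ (v₀ + θ v₁ + θ² v₂, v₁ + θ' v₂, v₂)` as a homeomorphism. -/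
def shearHomeomorph (θ θ' : ℝ) : E3 ≃ₜ ℝ × ℝ × ℝ where
  toFun v := (momentForm θ v, v 1 + θ' * v 2, v 2)
  invFun w := ![w.1 - θ * (w.2.1 - θ' * w.2.2) - θ ^ 2 * w.2.2, w.2.1 - θ' * w.2.2, w.2.2]
  left_inv v := by
    ext i
    fin_cases i
    · simp [momentForm_apply]
      ring
    · simp
    · simp
  right_inv w := by
    refine Prod.ext ?_ (Prod.ext ?_ ?_)
    · simp [momentForm_apply]
      ring
    · simp
    · simp
  continuous_toFun := by fun_prop
  continuous_invFun := by
    refine continuous_pi fun i => ?_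
    fin_cases i <;> simp <;> fun_prop

/-- The identification `(a, b, c) ↦ ![a, b, c]` as a linear equivalence. -/
def tripleEquiv : (ℝ × ℝ × ℝ) ≃ₗ[ℝ] E3 where
  toFun w := ![w.1, w.2.1, w.2.2]
  invFun v := (v 0, v 1, v 2)
  map_add' w w' := by ext i; fin_cases i <;> simp
  map_smul' c w := by ext i; fin_cases i <;> simp
  left_inv w := by simp
  right_inv v := by ext i; fin_cases i <;> simp

/-- Finitely many piecewise analytic edges can be straightened after a shear. -/
lemma exists_shear_straighten {n : ℕ} {e : Fin n → ℝ → E3} (he : ∀ i, IsPAEdge (e i)) :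
    ∃ (θ θ' : ℝ) (Φ : (ℝ × ℝ × ℝ) ≃ₜ (ℝ × ℝ × ℝ)), ∀ i, ∃ T : Set ℝ, T.Finite ∧ 0 ∈ T ∧ 1 ∈ T ∧
      T ⊆ Icc 0 1 ∧
      (∀ τ ∈ T, Φ (shearHomeomorph θ θ' (e i τ)) = shearHomeomorph θ θ' (e i τ)) ∧
      ∀ τ ∈ T, ∀ τ' ∈ T, τ < τ' → (∀ σ ∈ Ioo τ τ', σ ∉ T) →
        (fun t => Φ (shearHomeomorph θ θ' (e i t))) '' Icc τ τ' =
          segment ℝ (shearHomeomorph θ θ' (e i τ)) (shearHomeomorph θ θ' (e i τ')) := by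
  choose B hB hreg using fun i => (he i).exists_finite_branchRegular
  obtain ⟨θ, hθ⟩ := (finite_iUnion hB).infinite_compl.nonempty
  have hreg' : ∀ i, BranchRegular (fun t => momentForm θ (e i t)) (fun t => (e i t 1, e i t 2)) :=
    fun i => hreg i θ fun h => hθ (mem_iUnion.2 ⟨i, h⟩)
  choose C hC hcr using fun p : Fin n × Fin n =>
    (hreg' p.1).exists_finite_crossings (hreg' p.2)
  obtain ⟨θ', hθ'⟩ := (finite_iUnion hC).infinite_compl.nonempty
  choose F hF hcross using fun p => hcr p θ' fun h => hθ' (mem_iUnion.2 ⟨p, h⟩)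
  have hcont : ∀ i, ContinuousOn (e i) (Icc 0 1) := fun i => (he i).1
  have hc : ∀ i (m : Fin 3), ContinuousOn (fun t => e i t m) (Icc 0 1) := fun i m =>
    (continuous_apply m).comp_continuousOn (hcont i)
  obtain ⟨Φ, hΦ⟩ := exists_homeomorph_straighten (x := fun i t => momentForm θ (e i t))
    (y := fun i t => e i t 1 + θ' * e i t 2) (z := fun i t => e i t 2)
    (fun i => (momentForm θ).continuous.comp_continuousOn (hcont i))
    (fun i => (hc i 1).add (continuousOn_const.mul (hc i 2))) (fun i => hc i 2)
    (fun i c => (hreg' i).finite_fiber c) (fun i => (hreg' i).finite_extr) (finite_iUnion hF)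
    (fun i j s hs t ht hxx hxF hyy => by
      filter_upwards [hcross (i, j) (s, t) ⟨hs, ht⟩ hxx
        (fun h => hxF (mem_iUnion.2 ⟨(i, j), h⟩)) hyy] with q hq hqx
      have h1 := congrArg Prod.fst (hq hqx)
      have h2 := congrArg Prod.snd (hq hqx)
      simp only at h1 h2
      exact ⟨by rw [h1, h2], h2⟩)
  exact ⟨θ, _, Φ, hΦ⟩

/-- Every knot class of a piecewise analytic graph contains a piecewise linear graph: for every
piecewise analytic graph `γ = (e₁, …, eₙ)` there are a piecewise linear graph `α = (f₁, …, fₙ)`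
and a homeomorphism `ξ` of `ℝ³` carrying each `eᵢ` onto `fᵢ`, preserving endpoints. -/
theorem pa_graph_homeo_to_pl_graph (n : ℕ) (e : Fin n → ℝ → E3) (he : ∀ i, IsPAEdge (e i)) :
    ∃ f : Fin n → ℝ → E3, (∀ i, IsPLEdge (f i)) ∧
      ∃ ξ : Homeomorph E3 E3,
        ∀ i, ξ '' (e i '' Set.Icc 0 1) = f i '' Set.Icc 0 1 ∧
          ξ (e i 0) = f i 0 ∧ ξ (e i 1) = f i 1 := by
  obtain ⟨θ, θ', Φ, hΦ⟩ := exists_shear_straighten he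
  set ξ : E3 ≃ₜ E3 := (shearHomeomorph θ θ').trans
    (Φ.trans tripleEquiv.toContinuousLinearEquiv.toHomeomorph) with hξ
  have hξ_apply : ∀ v, ξ v = tripleEquiv (Φ (shearHomeomorph θ θ' v)) := fun v => rfl
  have hf : ∀ i, ∃ f, IsPLEdge f ∧ (fun t => ξ (e i t)) '' Icc 0 1 = f '' Icc 0 1 ∧
      ξ (e i 0) = f 0 ∧ ξ (e i 1) = f 1 := by
    intro i
    obtain ⟨T, hT, h0, h1, hT01, hfix, hseg⟩ := hΦ i
    refine exists_isPLEdge (c := fun t => ξ (e i t)) (ξ.injective.comp_injOn (he i).2.1) hT h0 h1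
      hT01 fun τ hτ τ' hτ' hlt hgap => ?_
    simp only [hξ_apply]
    have himg := image_segment ℝ tripleEquiv.toLinearMap.toAffineMap
      (shearHomeomorph θ θ' (e i τ)) (shearHomeomorph θ θ' (e i τ'))
    rw [← hseg τ hτ τ' hτ' hlt hgap, image_image] at himg
    rw [hfix τ hτ, hfix τ' hτ']
    exact himg
  choose f hfPL hfim hf0 hf1 using hf
  exact ⟨f, hfPL, ξ, fun i => ⟨by rw [image_image]; exact hfim i, hf0 i, hf1 i⟩⟩
end

section
/- Let γ = (e₁, …, eₙ) and γ' = (e₁', …, eₙ') be piecewise linear graphs in ℝ³ such that the images of distinct edges of γ' intersect at most in common endpoints (any point lying on two distinct edge images is an endpoint of both) and such that eᵢ'(0) ≠ eᵢ'(1) for each i. Let ξ : [0,1] × ℝ³ → ℝ³ be continuous, with each ξ_t := ξ(t, ·) a homeomorphism of ℝ³, and suppose that for every t ∈ [0,1], ξ_t maps the union of the images of the edges of γ onto the union of the images of the edges of γ', and maps the image of each edge of γ onto the image of some edge of γ'. If ξ₀ maps the image of eᵢ onto the image of eᵢ' with ξ₀(eᵢ(0)) = eᵢ'(0) and ξ₀(eᵢ(1))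 = eᵢ'(1) for each i, then for every t ∈ [0,1] and every i, ξ_t maps the image of eᵢ onto the image of eᵢ' with ξ_t(eᵢ(0)) = eᵢ'(0) and ξ_t(eᵢ(1)) = eᵢ'(1). -/
open Set

/-- Removing an interior point from an arc disconnects it. -/
theorem eq_endpoint_of_isPreconnected_sdiff {X : Type*} [TopologicalSpace X] [T2Space X]
    {g : ℝ → X} (hg : ContinuousOn g (Icc 0 1)) (hinj : InjOn g (Icc 0 1)) {x : X}
    (hx : x ∈ g '' Icc 0 1) (hP : IsPreconnected (g '' Icc 0 1 \ {x})) :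
    x = g 0 ∨ x = g 1 := by
  obtain ⟨s, hs, rfl⟩ := hx
  by_contra! h
  have hleft : Icc 0 s ⊆ Icc (0 : ℝ) 1 := Icc_subset_Icc_right hs.2
  have hright : Icc s 1 ⊆ Icc (0 : ℝ) 1 := Icc_subset_Icc_left hs.1
  have hc0 : IsClosed (g '' Icc 0 s) :=
    (isCompact_Icc.image_of_continuousOn (hg.mono hleft)).isClosed
  have hc1 : IsClosed (g '' Icc s 1) :=
    (isCompact_Icc.image_of_continuousOn (hg.mono hright)).isClosed
  obtain ⟨y, ⟨-, hy⟩, ⟨a, ha, rfl⟩, ⟨b, hb, hab⟩⟩ :=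
    isPreconnected_closed_iff.1 hP _ _ hc0 hc1
      (by
        rintro _ ⟨⟨u, hu, rfl⟩, -⟩
        rcases le_total u s with h | h
        · exact Or.inl ⟨u, ⟨hu.1, h⟩, rfl⟩
        · exact Or.inr ⟨u, ⟨h, hu.2⟩, rfl⟩)
      ⟨g 0, ⟨⟨0, by simp, rfl⟩, fun h' => h.1 h'.symm⟩, ⟨0, ⟨le_rfl, hs.1⟩, rfl⟩⟩
      ⟨g 1, ⟨⟨1, by simp, rfl⟩, fun h' => h.2 h'.symm⟩, ⟨1, ⟨hs.2, le_rfl⟩, rfl⟩⟩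
  have hba : b = a := hinj (hright hb) (hleft ha) hab
  subst hba
  exact hy (by rw [le_antisymm ha.2 hb.1]; rfl)

/-- Two parametrizations of the same arc have the same pair of endpoints. -/
theorem endpoints_of_image_Icc_eq {X : Type*} [TopologicalSpace X] [T2Space X]
    {f g : ℝ → X} (hf : ContinuousOn f (Icc 0 1)) (hfinj : InjOn f (Icc 0 1))
    (hg : ContinuousOn g (Icc 0 1)) (hginj : InjOn g (Icc 0 1))
    (h : f '' Icc 0 1 = g '' Icc 0 1) :
    (f 0 = g 0 ∨ f 0 = g 1) ∧ (f 1 = g 0 ∨ f 1 = g 1) := by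
  have key : ∀ c ∈ Icc (0 : ℝ) 1, IsPreconnected (Icc (0 : ℝ) 1 \ {c}) →
      f c = g 0 ∨ f c = g 1 := by
    intro c hc hP
    refine eq_endpoint_of_isPreconnected_sdiff hg hginj (h ▸ mem_image_of_mem f hc) ?_
    rw [← h, ← image_singleton, ← hfinj.image_sdiff_subset (singleton_subset_iff.2 hc)]
    exact hP.image f (hf.mono sdiff_subset)
  refine ⟨key 0 (by simp) ?_, key 1 (by simp) ?_⟩
  · rw [Icc_sdiff_left]
    exact isPreconnected_Ioc
  · rw [Icc_sdiff_right]
    exact isPreconnected_Ico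

/-- An isotopy carrying a piecewise linear graph onto another edge-wise must carry each edge
to the same target edge, with the same orientation, for all times: the continuity argument of
Lemma 2 of the paper. -/
theorem isotopy_preserves_edge_assignment (n : ℕ) (e e' : Fin n → ℝ → E3)
    (he : ∀ i, IsPLEdge (e i)) (he' : ∀ i, IsPLEdge (e' i))
    (hmeet : ∀ i j, i ≠ j → ∀ x, x ∈ e' i '' Set.Icc 0 1 → x ∈ e' j '' Set.Icc 0 1 →
      (x = e' i 0 ∨ x = e' i 1) ∧ (x = e' j 0 ∨ x = e' j 1))
    (hne : ∀ i, e' i 0 ≠ e' i 1)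
    (Ξ : ℝ → Homeomorph E3 E3)
    (hcont : ContinuousOn (fun p : ℝ × E3 => Ξ p.1 p.2) (Set.Icc 0 1 ×ˢ Set.univ))
    (hunion : ∀ t ∈ Set.Icc (0 : ℝ) 1,
      Ξ t '' (⋃ i, e i '' Set.Icc 0 1) = ⋃ i, e' i '' Set.Icc 0 1)
    (hedge : ∀ t ∈ Set.Icc (0 : ℝ) 1, ∀ i, ∃ j,
      Ξ t '' (e i '' Set.Icc 0 1) = e' j '' Set.Icc 0 1)
    (hinit : ∀ i, Ξ 0 '' (e i '' Set.Icc 0 1) = e' i '' Set.Icc 0 1 ∧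
      Ξ 0 (e i 0) = e' i 0 ∧ Ξ 0 (e i 1) = e' i 1) :
    ∀ t ∈ Set.Icc (0 : ℝ) 1, ∀ i,
      Ξ t '' (e i '' Set.Icc 0 1) = e' i '' Set.Icc 0 1 ∧
      Ξ t (e i 0) = e' i 0 ∧ Ξ t (e i 1) = e' i 1 := by
  have hcontAt : ∀ x, ContinuousOn (fun t => Ξ t x) (Icc 0 1) := fun x =>
    hcont.comp (f := fun t : ℝ => (t, x)) (by fun_prop) fun t ht => ⟨ht, mem_univ _⟩
  have h0mem : (0 : ℝ) ∈ Icc (0 : ℝ) 1 := by simp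
  have h1mem : (1 : ℝ) ∈ Icc (0 : ℝ) 1 := by simp
  have hends : ∀ t i j, Ξ t '' (e i '' Icc 0 1) = e' j '' Icc 0 1 →
      (Ξ t (e i 0) = e' j 0 ∨ Ξ t (e i 0) = e' j 1) ∧
      (Ξ t (e i 1) = e' j 0 ∨ Ξ t (e i 1) = e' j 1) := by
    intro t i j h
    rw [image_image] at h
    exact endpoints_of_image_Icc_eq ((Ξ t).continuous.comp_continuousOn (he i).1)
      (fun a ha b hb hab => (he i).2.1 ha hb ((Ξ t).injective hab)) (he' j).1 (he' j).2.1 h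
  intro t ht i
  let V : Set E3 := range (fun j => e' j 0) ∪ range (fun j => e' j 1)
  have hV : V.Finite := (finite_range _).union (finite_range _)
  have hconst : ∀ x, (∀ s ∈ Icc (0 : ℝ) 1, Ξ s x ∈ V) → Ξ t x = Ξ 0 x := fun x hx =>
    isPreconnected_Icc.constant_of_mapsTo hV.isDiscrete (hcontAt x) hx ht h0mem
  have hstart : Ξ t (e i 0) = e' i 0 := by
    refine (hconst _ fun s hs => ?_).trans (hinit i).2.1
    obtain ⟨j, hj⟩ := hedge s hs i
    exact (hends s i j hj).1.imp (fun h => ⟨j, h.symm⟩) fun h => ⟨j, h.symm⟩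
  have hend : Ξ t (e i 1) = e' i 1 := by
    refine (hconst _ fun s hs => ?_).trans (hinit i).2.2
    obtain ⟨j, hj⟩ := hedge s hs i
    exact (hends s i j hj).2.imp (fun h => ⟨j, h.symm⟩) fun h => ⟨j, h.symm⟩
  refine ⟨?_, hstart, hend⟩
  have hmid : (1 / 2 : ℝ) ∈ Icc (0 : ℝ) 1 := by constructor <;> norm_num
  set p : E3 := e i (1 / 2)
  have hp0 : p ≠ e i 0 := fun h => by have := (he i).2.1 hmid h0mem h; norm_num at this
  have hp1 : p ≠ e i 1 := fun h => by have := (he i).2.1 hmid h1mem h; norm_num at this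
  have h01 : e i 0 ≠ e i 1 := fun h => by have := (he i).2.1 h0mem h1mem h; norm_num at this
  have hmem : ∀ s j, Ξ s '' (e i '' Icc 0 1) = e' j '' Icc 0 1 → Ξ s p ∈ e' j '' Icc 0 1 :=
    fun s j h => h ▸ mem_image_of_mem _ (mem_image_of_mem _ hmid)
  -- The midpoint of the edge never reaches an endpoint, so it determines the target edge.
  have huniq : ∀ s j k, Ξ s '' (e i '' Icc 0 1) = e' j '' Icc 0 1 →
      Ξ s p ∈ e' k '' Icc 0 1 → k = j := by
    intro s j k hj hk
    by_contra hkj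
    have h0 := (Ξ s).injective.ne hp0
    have h1 := (Ξ s).injective.ne hp1
    have h2 := (Ξ s).injective.ne h01
    have h3 := hends s i j hj
    have h4 := (hmeet k j hkj _ hk (hmem s j hj)).2
    grind
  have hclosed : ∀ j, IsClosed (e' j '' Icc 0 1) := fun j =>
    (isCompact_Icc.image_of_continuousOn (he' j).1).isClosed
  have hpath : IsPreconnected ((fun s => Ξ s p) '' Icc 0 1) :=
    isPreconnected_Icc.image _ (hcontAt p)
  have hcover : Ξ t p ∈ e' i '' Icc 0 1 := by
    by_contra hnot
    obtain ⟨j, hj⟩ := hedge t ht i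
    have hji : j ≠ i := fun h => hnot (h ▸ hmem t j hj)
    obtain ⟨_, ⟨s, hs, rfl⟩, hsi, hsk⟩ := isPreconnected_closed_iff.1 hpath
      (e' i '' Icc 0 1) (⋃ k : {k // k ≠ i}, e' k '' Icc 0 1) (hclosed i)
      (isClosed_iUnion_of_finite fun k => hclosed k)
      (by
        rintro _ ⟨s, hs, rfl⟩
        obtain ⟨k, hk⟩ := hedge s hs i
        by_cases hki : k = i
        · exact Or.inl (hki ▸ hmem s k hk)
        · exact Or.inr (mem_iUnion.2 ⟨⟨k, hki⟩, hmem s k hk⟩))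
      ⟨Ξ 0 p, ⟨0, h0mem, rfl⟩, hmem 0 i (hinit i).1⟩
      ⟨Ξ t p, ⟨t, ht, rfl⟩, mem_iUnion.2 ⟨⟨j, hji⟩, hmem t j hj⟩⟩
    obtain ⟨⟨k, hki⟩, hk⟩ := mem_iUnion.1 hsk
    obtain ⟨m, hm⟩ := hedge s hs i
    exact hki ((huniq s m k hm hk).trans (huniq s m i hm hsi).symm)
  obtain ⟨j, hj⟩ := hedge t ht i
  rw [hj, huniq t j i hj hcover]
end
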